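/- arXiv:1603.02239 — 5 statements merged into one kernel-verified Lean document; each statement's English description precedes it below -/
import Mathlib

section
/- For every k ≥ 1 and every minimizer x* ∈ X*: 2c(k)∑_{i=1}^m f_i(v̄(k+1)) + ∑_{i=1}^m ‖e_i(k+1)‖² + ∑_{i=1}^m ‖x_i(k+1) − x*‖² ≤ 2c(k)∑_{i=1}^m f_i(x*) + ∑_{i=1}^m ‖x_i(k) − x*‖² + 2L̄ c(k) ∑_{i=1}^m ‖x_i(k+1) − v̄(k+1)‖. -/
open Filter Finset Metric
open scoped Topology BigOperators

lemma norm_sq_sub_convexCombination {E : Type*} [NormedAddCommGroup E] [InnerProductSpace ℝ E]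
    (z p y : E) (t : ℝ) :
    ‖z - ((1 - t) • p + t • y)‖ ^ 2
      = (1 - t) * ‖z - p‖ ^ 2 + t * ‖z - y‖ ^ 2 - t * (1 - t) * ‖p - y‖ ^ 2 := by
  have h1 : z - ((1 - t) • p + t • y) = (1 - t) • (z - p) + t • (z - y) := by module
  have h2 : p - y = (z - y) - (z - p) := by abel
  rw [h1, h2, norm_add_sq_real, norm_sub_sq_real (z - y) (z - p), norm_smul, norm_smul,
    real_inner_smul_left, real_inner_smul_right, real_inner_comm (z - p) (z - y), mul_pow, mul_pow,
    Real.norm_eq_abs, Real.norm_eq_abs, sq_abs, sq_abs]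
  ring

lemma prox_three_point {E : Type*} [NormedAddCommGroup E] [InnerProductSpace ℝ E]
    {S : Set E} {g : E → ℝ} (hg : ConvexOn ℝ S g) {c : ℝ} (hc : 0 < c) {z p : E}
    (hp : p ∈ S)
    (hmin : ∀ y ∈ S, g p + (1 / (2 * c)) * ‖z - p‖ ^ 2 ≤ g y + (1 / (2 * c)) * ‖z - y‖ ^ 2)
    {y : E} (hy : y ∈ S) :
    2 * c * g p + ‖p - z‖ ^ 2 + ‖p - y‖ ^ 2 ≤ 2 * c * g y + ‖z - y‖ ^ 2 := by
  have key : ∀ t ∈ Set.Ioo (0 : ℝ) 1,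
      2 * c * g p + ‖p - z‖ ^ 2 + (1 - t) * ‖p - y‖ ^ 2 ≤ 2 * c * g y + ‖z - y‖ ^ 2 := by
    rintro t ⟨ht0, ht1⟩
    have hw := hg.1 hp hy (sub_pos.2 ht1).le ht0.le (by ring)
    have hgw := hg.2 hp hy (sub_pos.2 ht1).le ht0.le (by ring)
    have hm := hmin _ hw
    rw [norm_sq_sub_convexCombination] at hm
    simp only [smul_eq_mul] at hgw
    have hm' := mul_le_mul_of_nonneg_left (hm.trans (add_le_add_left hgw _))
      (by positivity : 0 ≤ 2 * c)
    have hcc : 2 * c * (1 / (2 * c)) = 1 := by field_simp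
    simp only [mul_add, ← mul_assoc, hcc, one_mul] at hm'
    rw [norm_sub_rev p z]
    refine le_of_mul_le_mul_left ?_ ht0
    linarith
  have hlim : Tendsto (fun t : ℝ => 2 * c * g p + ‖p - z‖ ^ 2 + (1 - t) * ‖p - y‖ ^ 2)
      (𝓝[>] 0) (𝓝 (2 * c * g p + ‖p - z‖ ^ 2 + (1 - 0) * ‖p - y‖ ^ 2)) :=
    (Continuous.tendsto (by fun_prop) 0).mono_left nhdsWithin_le_nhds
  rw [sub_zero, one_mul] at hlim
  exact le_of_tendsto hlim
    (eventually_of_mem (Ioo_mem_nhdsGT one_pos) key)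

lemma norm_sq_sum_smul_sub_le {ι E : Type*} [Fintype ι] [NormedAddCommGroup E]
    [InnerProductSpace ℝ E] {w : ι → ℝ} (hw : ∀ j, 0 ≤ w j) (hw1 : ∑ j, w j = 1)
    (x : ι → E) (y : E) :
    ‖(∑ j, w j • x j) - y‖ ^ 2 ≤ ∑ j, w j * ‖x j - y‖ ^ 2 := by
  have h : (∑ j, w j • x j) - y = ∑ j, w j • (x j - y) := by
    simp only [smul_sub, sum_sub_distrib, ← sum_smul, hw1, one_smul]
  have hconv : ConvexOn ℝ Set.univ (fun u : E => ‖u‖ ^ 2) :=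
    convexOn_univ_norm.pow (fun _ _ => norm_nonneg _) 2
  rw [h]
  simpa only [smul_eq_mul] using
    hconv.map_sum_le (t := univ) (p := fun j => x j - y) (fun j _ => hw j) hw1
      (fun _ _ => Set.mem_univ _)

/-- A point at distance at most `ε` from a compact convex set containing `ball b ρ` is brought into
the set by moving it towards `b` with weight `ε / (ε + ρ)`. -/
lemma convexCombination_mem_of_infDist_le {E : Type*} [NormedAddCommGroup E] [NormedSpace ℝ E]
    {S : Set E} (hcpt : IsCompact S) (hconv : Convex ℝ S) {b : E} {ρ : ℝ} (hρ : 0 < ρ)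
    (hball : ball b ρ ⊆ S) {u : E} {ε : ℝ} (hε : infDist u S ≤ ε) :
    (ε / (ε + ρ)) • b + (ρ / (ε + ρ)) • u ∈ S := by
  have hne : S.Nonempty := ⟨b, hball (mem_ball_self hρ)⟩
  obtain ⟨p, hp, hpu⟩ := hcpt.exists_infDist_eq_dist hne u
  rw [hpu, dist_eq_norm] at hε
  have hε0 : 0 ≤ ε := (norm_nonneg _).trans hε
  have hcball : closedBall b ρ ⊆ S := by
    rw [← closure_ball b hρ.ne']
    exact closure_minimal hball hcpt.isClosed
  have hq : b + (ρ / ε) • (u - p) ∈ S := by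
    refine hcball ?_
    rw [mem_closedBall, dist_eq_norm, add_sub_cancel_left, norm_smul, Real.norm_eq_abs,
      abs_of_nonneg (by positivity), div_mul_eq_mul_div]
    exact div_le_of_le_mul₀ hε0 hρ.le (mul_le_mul_of_nonneg_left hε hρ.le)
  have hmem := hconv hq hp (a := ε / (ε + ρ)) (b := ρ / (ε + ρ)) (by positivity) (by positivity)
    (by field_simp)
  convert hmem using 1
  rcases hε0.eq_or_lt with rfl | hpos
  · have : u = p := by simpa [sub_eq_zero] using hε
    simp [this]
  · rw [smul_add, smul_smul, div_mul_div_comm, mul_comm ε ρ, mul_div_mul_right _ _ hpos.ne']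
    module

theorem stmt7
    (n m : ℕ) (hm : 1 ≤ m)
    (X : Fin m → Set (EuclideanSpace ℝ (Fin n)))
    (hXne : ∀ i, (X i).Nonempty)
    (hXcpt : ∀ i, IsCompact (X i))
    (hXconv : ∀ i, Convex ℝ (X i))
    (f : Fin m → EuclideanSpace ℝ (Fin n) → ℝ)
    (hfconv : ∀ i, ConvexOn ℝ Set.univ (f i))
    (Lbar : ℝ) (hLbar : 0 < Lbar)
    (hLip : ∀ i, ∀ p₁ ∈ X i, ∀ p₂ ∈ X i, |f i p₁ - f i p₂| ≤ Lbar * ‖p₁ - p₂‖)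
    (xbar : EuclideanSpace ℝ (Fin n)) (ρ : ℝ) (hρ : 0 < ρ)
    (hball : Metric.ball xbar ρ ⊆ ⋂ i, X i)
    (Xstar : Set (EuclideanSpace ℝ (Fin n)))
    (hXstar : Xstar = {p | p ∈ ⋂ i, X i ∧ ∀ y ∈ ⋂ i, X i, ∑ i, f i p ≤ ∑ i, f i y})
    (hXstar_ne : Xstar.Nonempty)
    (a : ℕ → Fin m → Fin m → ℝ)
    (ha_nonneg : ∀ k i j, 0 ≤ a k i j)
    (ha_row : ∀ k i, ∑ j, a k i j = 1)
    (ha_col : ∀ k j, ∑ i, a k i j = 1)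
    (c : ℕ → ℝ) (hc_pos : ∀ k, 0 < c k)
    (x : Fin m → ℕ → EuclideanSpace ℝ (Fin n))
    (hx0 : ∀ i, x i 0 ∈ X i)
    (z : Fin m → ℕ → EuclideanSpace ℝ (Fin n))
    (hz : ∀ i k, z i k = ∑ j, a k i j • x j k)
    (hupd_mem : ∀ i k, x i (k+1) ∈ X i)
    (hupd_min : ∀ i k, ∀ y ∈ X i,
      f i (x i (k+1)) + (1/(2 * c k)) * ‖z i k - x i (k+1)‖^2
        ≤ f i y + (1/(2 * c k)) * ‖z i k - y‖^2)
    (hupd_uniq : ∀ i k, ∀ y ∈ X i,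
      f i y + (1/(2 * c k)) * ‖z i k - y‖^2
        = f i (x i (k+1)) + (1/(2 * c k)) * ‖z i k - x i (k+1)‖^2 → y = x i (k+1))
    (v : ℕ → EuclideanSpace ℝ (Fin n))
    (hv : ∀ k, v k = (m : ℝ)⁻¹ • ∑ i, x i k)
    (eps : ℕ → ℝ)
    (heps : ∀ k, eps k = ∑ i, Metric.infDist (v k) (X i))
    (vbar : ℕ → EuclideanSpace ℝ (Fin n))
    (hvbar : ∀ k, vbar k = (eps k / (eps k + ρ)) • xbar + (ρ / (eps k + ρ)) • v k)
    :
    ∀ k : ℕ, 1 ≤ k → ∀ xstar ∈ Xstar,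
      2 * c k * (∑ i, f i (vbar (k + 1))) + (∑ i, ‖x i (k + 1) - z i k‖^2)
          + (∑ i, ‖x i (k + 1) - xstar‖^2)
        ≤ 2 * c k * (∑ i, f i xstar) + (∑ i, ‖x i k - xstar‖^2)
          + 2 * Lbar * c k * ∑ i, ‖x i (k + 1) - vbar (k + 1)‖ := by
  intro k _ xstar hxs
  subst hXstar
  have hxsX : ∀ i, xstar ∈ X i := Set.mem_iInter.1 hxs.1
  have hvX : ∀ i, vbar (k + 1) ∈ X i := fun i => by
    rw [hvbar]
    refine convexCombination_mem_of_infDist_le (hXcpt i) (hXconv i) hρ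
      (hball.trans (Set.iInter_subset X i)) ?_
    rw [heps]
    exact single_le_sum (f := fun i => infDist (v (k + 1)) (X i)) (fun _ _ => infDist_nonneg)
      (mem_univ i)
  have hlocal : ∀ i, 2 * c k * f i (vbar (k + 1)) + ‖x i (k + 1) - z i k‖ ^ 2
      + ‖x i (k + 1) - xstar‖ ^ 2
      ≤ 2 * c k * f i xstar + ∑ j, a k i j * ‖x j k - xstar‖ ^ 2
        + 2 * Lbar * c k * ‖x i (k + 1) - vbar (k + 1)‖ := fun i => by
    have hprox := prox_three_point ((hfconv i).subset (Set.subset_univ _) (hXconv i)) (hc_pos k)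
      (hupd_mem i k) (hupd_min i k) (hxsX i)
    have havg := norm_sq_sum_smul_sub_le (ha_nonneg k i) (ha_row k i) (fun j => x j k) xstar
    rw [← hz] at havg
    have hL := (neg_le_of_abs_le (hLip i _ (hupd_mem i k) _ (hvX i)))
    have hLc := mul_le_mul_of_nonneg_left hL (mul_pos two_pos (hc_pos k)).le
    linarith
  have hsum := sum_le_sum fun i (_ : i ∈ univ) => hlocal i
  have hweights : ∑ i, ∑ j, a k i j * ‖x j k - xstar‖ ^ 2 = ∑ j, ‖x j k - xstar‖ ^ 2 := by
    rw [sum_comm]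
    simp only [← sum_mul, ha_col, one_mul]
  simpa only [sum_add_distrib, ← mul_sum, hweights] using hsum
end

section
/- Under the full assumptions and Algorithm 1, the nonnegative series 2L̄ ∑_{k=1}^∞ c(k) ∑_{i=1}^m ‖x_i(k+1) − v̄(k+1)‖ is finite (convergent). -/
open Filter Finset Metric
open scoped Topology BigOperators

section Consensus

variable {ι E : Type*} [Fintype ι] [NormedAddCommGroup E] [NormedSpace ℝ E]

/-- Total distance of a family of points from its mean. -/
noncomputable def disagreement (y : ι → E) : ℝ :=
  ∑ i, ‖y i - (Fintype.card ι : ℝ)⁻¹ • ∑ j, y j‖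

/-- The action of a real matrix on a family of vectors. -/
def mixing (P : Matrix ι ι ℝ) (y : ι → E) : ι → E := fun i => ∑ j, P i j • y j

lemma disagreement_nonneg (y : ι → E) : 0 ≤ disagreement y :=
  Finset.sum_nonneg fun _ _ => norm_nonneg _

lemma disagreement_add_le (y w : ι → E) :
    disagreement (y + w) ≤ disagreement y + disagreement w := by
  unfold disagreement
  rw [← Finset.sum_add_distrib]
  refine Finset.sum_le_sum fun i _ => ?_
  refine le_trans (le_of_eq ?_) (norm_add_le _ _)
  congr 1
  simp only [Pi.add_apply, Finset.sum_add_distrib, smul_add]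
  abel

lemma disagreement_le_two_mul_sum_norm [Nonempty ι] (y : ι → E) :
    disagreement y ≤ 2 * ∑ i, ‖y i‖ := by
  have hcard : (0 : ℝ) < Fintype.card ι := by exact_mod_cast Fintype.card_pos
  have hmean : ‖(Fintype.card ι : ℝ)⁻¹ • ∑ j, y j‖ ≤ (Fintype.card ι : ℝ)⁻¹ * ∑ j, ‖y j‖ := by
    rw [norm_smul, Real.norm_of_nonneg (by positivity)]
    gcongr
    exact norm_sum_le _ _
  calc disagreement y ≤ ∑ i, (‖y i‖ + (Fintype.card ι : ℝ)⁻¹ * ∑ j, ‖y j‖) :=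
        Finset.sum_le_sum fun i _ => (norm_sub_le _ _).trans (by gcongr)
    _ = 2 * ∑ i, ‖y i‖ := by
        rw [Finset.sum_add_distrib, Finset.sum_const, Finset.card_univ, nsmul_eq_mul]
        field_simp
        ring

lemma mixing_add (P : Matrix ι ι ℝ) (y w : ι → E) :
    mixing P (y + w) = mixing P y + mixing P w := by
  funext i
  simp [mixing, Finset.sum_add_distrib]

lemma mixing_mul (P Q : Matrix ι ι ℝ) (y : ι → E) :
    mixing (P * Q) y = mixing P (mixing Q y) := by
  funext i
  simp only [mixing, Matrix.mul_apply, Finset.sum_smul, Finset.smul_sum, smul_smul]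
  exact Finset.sum_comm

lemma mixing_one [DecidableEq ι] (y : ι → E) : mixing (1 : Matrix ι ι ℝ) y = y := by
  funext i
  simp [mixing, Matrix.one_apply]

lemma sum_mixing [DecidableEq ι] {P : Matrix ι ι ℝ} (hP : P ∈ doublyStochastic ℝ ι) (y : ι → E) :
    ∑ i, mixing P y i = ∑ i, y i := by
  unfold mixing
  rw [Finset.sum_comm]
  simp_rw [← Finset.sum_smul, sum_col_of_mem_doublyStochastic hP, one_smul]

/-- A doubly stochastic matrix with entries bounded below by `δ` contracts the disagreement. -/
lemma disagreement_mixing_le [DecidableEq ι] [Nonempty ι] {P : Matrix ι ι ℝ}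
    (hP : P ∈ doublyStochastic ℝ ι) {δ : ℝ} (hδ : ∀ i j, δ ≤ P i j) (y : ι → E) :
    disagreement (mixing P y) ≤ (1 - Fintype.card ι * δ) * disagreement y := by
  have hcard : (Fintype.card ι : ℝ) ≠ 0 := by exact_mod_cast Fintype.card_ne_zero
  set μ : E := (Fintype.card ι : ℝ)⁻¹ • ∑ j, y j with hμ
  have hzero : ∑ j, (y j - μ) = 0 := by
    rw [Finset.sum_sub_distrib, Finset.sum_const, Finset.card_univ, ← Nat.cast_smul_eq_nsmul ℝ,
      hμ, smul_inv_smul₀ hcard, sub_self]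
  have hdev (i : ι) : mixing P y i - μ = ∑ j, (P i j - δ) • (y j - μ) := by
    simp_rw [sub_smul (P i _) δ, Finset.sum_sub_distrib, ← Finset.smul_sum, hzero, smul_zero,
      sub_zero, smul_sub, Finset.sum_sub_distrib, ← Finset.sum_smul,
      sum_row_of_mem_doublyStochastic hP, one_smul]
    rfl
  calc disagreement (mixing P y) = ∑ i, ‖∑ j, (P i j - δ) • (y j - μ)‖ := by
        simp only [disagreement, sum_mixing hP, ← hμ, hdev]
    _ ≤ ∑ i, ∑ j, (P i j - δ) * ‖y j - μ‖ := by
        refine Finset.sum_le_sum fun i _ => (norm_sum_le _ _).trans (le_of_eq ?_)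
        refine Finset.sum_congr rfl fun j _ => ?_
        rw [norm_smul, Real.norm_of_nonneg (sub_nonneg.2 (hδ i j))]
    _ = (1 - Fintype.card ι * δ) * disagreement y := by
        rw [Finset.sum_comm]
        simp_rw [← Finset.sum_mul, Finset.sum_sub_distrib, sum_col_of_mem_doublyStochastic hP]
        simp [disagreement, Finset.mul_sum, hμ]

/-- The product `A (k + s - 1) * ⋯ * A k`. -/
noncomputable def transitionMatrix [DecidableEq ι] (A : ℕ → Matrix ι ι ℝ) (k : ℕ) :
    ℕ → Matrix ι ι ℝ
  | 0 => 1
  | s + 1 => A (k + s) * transitionMatrix A k s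

lemma transitionMatrix_mem [DecidableEq ι] {A : ℕ → Matrix ι ι ℝ}
    (hA : ∀ k, A k ∈ doublyStochastic ℝ ι) (k s : ℕ) :
    transitionMatrix A k s ∈ doublyStochastic ℝ ι := by
  induction s with
  | zero => exact one_mem _
  | succ s ih => exact mul_mem (hA _) ih

lemma pow_le_transitionMatrix_succ [DecidableEq ι] {A : ℕ → Matrix ι ι ℝ}
    (hA : ∀ k, A k ∈ doublyStochastic ℝ ι) {η : ℝ} (hη : 0 ≤ η) {k s : ℕ} {i p j : ι}
    (hip : η ≤ A (k + s) i p) (hpj : η ^ s ≤ transitionMatrix A k s p j) :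
    η ^ (s + 1) ≤ transitionMatrix A k (s + 1) i j := by
  have hnn (q : ι) : 0 ≤ A (k + s) i q * transitionMatrix A k s q j :=
    mul_nonneg (nonneg_of_mem_doublyStochastic (hA _))
      (nonneg_of_mem_doublyStochastic (transitionMatrix_mem hA k s))
  calc η ^ (s + 1) = η * η ^ s := pow_succ' _ _
    _ ≤ A (k + s) i p * transitionMatrix A k s p j := by
        gcongr
        exact hη.trans hip
    _ ≤ _ := Finset.single_le_sum (fun q _ => hnn q) (Finset.mem_univ p)

/-- Under periodic strong connectivity and uniformly positive weights, long enough products of the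
mixing matrices have uniformly positive entries. -/
lemma exists_forall_pow_le_transitionMatrix [DecidableEq ι] {A : ℕ → Matrix ι ι ℝ}
    (hA : ∀ k, A k ∈ doublyStochastic ℝ ι) {η : ℝ} (hη : 0 ≤ η) (hdiag : ∀ k i, η ≤ A k i i)
    {r : ι → ι → Prop} (hr : ∀ i j, Relation.ReflTransGen r i j) {T : ℕ}
    (hT : ∀ j i, r j i → ∀ k, ∃ l, k ≤ l ∧ l < k + T ∧ η ≤ A l i j) :
    ∃ B, ∀ k i j, η ^ B ≤ transitionMatrix A k B i j := by
  have hmono {k s i j} (h : η ^ s ≤ transitionMatrix A k s i j) :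
      ∀ t, s ≤ t → η ^ t ≤ transitionMatrix A k t i j := by
    intro t hst
    induction t, hst using Nat.le_induction with
    | base => exact h
    | succ t _ ih => exact pow_le_transitionMatrix_succ hA hη (hdiag _ _) ih
  have hpath (j i : ι) : ∃ s, ∀ k, ∀ t, s ≤ t → η ^ t ≤ transitionMatrix A k t i j := by
    induction hr j i with
    | refl => exact ⟨0, fun k => hmono (by simp [transitionMatrix])⟩
    | tail _ hpq ih =>
      obtain ⟨s, hs⟩ := ih
      refine ⟨s + T, fun k t ht => ?_⟩
      obtain ⟨l, hl, hlT, hlη⟩ := hT _ _ hpq (k + s)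
      obtain ⟨t', rfl⟩ := Nat.exists_eq_add_of_le (show k ≤ l by omega)
      exact hmono (pow_le_transitionMatrix_succ hA hη hlη (hs k t' (by omega))) t (by omega)
  choose s hs using hpath
  refine ⟨∑ j, ∑ i, s j i, fun k i j => hs j i k _ ?_⟩
  calc s j i ≤ ∑ i, s j i := Finset.single_le_sum (fun _ _ => Nat.zero_le _) (Finset.mem_univ i)
    _ ≤ _ := Finset.single_le_sum (f := fun j => ∑ i, s j i) (fun _ _ => Nat.zero_le _)
        (Finset.mem_univ j)

lemma disagreement_mixing_le_self [DecidableEq ι] [Nonempty ι] {P : Matrix ι ι ℝ}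
    (hP : P ∈ doublyStochastic ℝ ι) (y : ι → E) :
    disagreement (mixing P y) ≤ disagreement y := by
  simpa using disagreement_mixing_le hP (fun _ _ => nonneg_of_mem_doublyStochastic hP) y

/-- Perturbed consensus: the disagreement after `s` steps is that of the unperturbed dynamics up to
the accumulated perturbations. -/
lemma disagreement_perturbed_le [DecidableEq ι] [Nonempty ι] {A : ℕ → Matrix ι ι ℝ}
    (hA : ∀ k, A k ∈ doublyStochastic ℝ ι) {y e : ℕ → ι → E}
    (hy : ∀ k, y (k + 1) = mixing (A k) (y k) + e k) (k s : ℕ) :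
    disagreement (y (k + s)) ≤ disagreement (mixing (transitionMatrix A k s) (y k)) +
      2 * ∑ r ∈ range s, ∑ i, ‖e (k + r) i‖ := by
  suffices h : ∃ w, y (k + s) = mixing (transitionMatrix A k s) (y k) + w ∧
      disagreement w ≤ 2 * ∑ r ∈ range s, ∑ i, ‖e (k + r) i‖ by
    obtain ⟨w, hw, hle⟩ := h
    rw [hw]
    exact (disagreement_add_le _ _).trans (by gcongr)
  induction s with
  | zero => exact ⟨0, by simp [transitionMatrix, mixing_one], by simp [disagreement]⟩
  | succ s ih =>
    obtain ⟨w, hw, hle⟩ := ih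
    refine ⟨mixing (A (k + s)) w + e (k + s), ?_, ?_⟩
    · rw [← add_assoc k s 1, hy, hw, mixing_add, transitionMatrix, mixing_mul, add_assoc]
    · rw [Finset.sum_range_succ, mul_add]
      exact (disagreement_add_le _ _).trans (add_le_add
        ((disagreement_mixing_le_self (hA _) _).trans hle) (disagreement_le_two_mul_sum_norm _))

end Consensus

/-- A weighted sum of a sequence that contracts over windows of length `B` up to perturbations is
controlled by the weighted sum of the perturbations. -/
lemma exists_sum_mul_le_of_window_contraction {c D E : ℕ → ℝ} (hc : Antitone c)
    (hc0 : ∀ k, 0 ≤ c k) (hD : ∀ k, 0 ≤ D k) (hE : ∀ k, 0 ≤ E k) {δ : ℝ} (hδ : 0 < δ)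
    (hδ1 : δ ≤ 1) {B : ℕ}
    (h : ∀ k, D (k + B) ≤ (1 - δ) * D k + 2 * ∑ r ∈ range B, E (k + r)) :
    ∃ C₁ C₂, 0 ≤ C₂ ∧
      ∀ N, ∑ k ∈ range N, c k * D k ≤ C₁ + C₂ * ∑ k ∈ range N, c k * E k := by
  have hu (k : ℕ) : 0 ≤ c k * D k := mul_nonneg (hc0 k) (hD k)
  have hw (k : ℕ) : 0 ≤ c k * E k := mul_nonneg (hc0 k) (hE k)
  have hstep (k : ℕ) : c (k + B) * D (k + B) ≤
      (1 - δ) * (c k * D k) + 2 * ∑ r ∈ range B, c (k + r) * E (k + r) := by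
    have h1 : c (k + B) * ((1 - δ) * D k) ≤ c k * ((1 - δ) * D k) :=
      mul_le_mul_of_nonneg_right (hc (by omega)) (mul_nonneg (by linarith) (hD k))
    have h2 : c (k + B) * ∑ r ∈ range B, E (k + r) ≤ ∑ r ∈ range B, c (k + r) * E (k + r) := by
      rw [Finset.mul_sum]
      refine Finset.sum_le_sum fun r hr => mul_le_mul_of_nonneg_right (hc ?_) (hE _)
      have := Finset.mem_range.1 hr
      omega
    have h3 := mul_le_mul_of_nonneg_left (h k) (hc0 (k + B))
    nlinarith
  set U : ℝ := ∑ k ∈ range B, c k * D k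
  refine ⟨U / δ, 2 * B / δ, by positivity, fun N => ?_⟩
  have hS0 : 0 ≤ ∑ k ∈ range N, c k * E k := Finset.sum_nonneg fun k _ => hw k
  suffices δ * ∑ k ∈ range N, c k * D k ≤ U + 2 * B * ∑ k ∈ range N, c k * E k by
    rw [div_mul_eq_mul_div, ← add_div, le_div_iff₀ hδ]
    linarith
  rcases le_total N B with hNB | hBN
  · have h1 : ∑ k ∈ range N, c k * D k ≤ U :=
      Finset.sum_le_sum_of_subset_of_nonneg (Finset.range_mono hNB) fun k _ _ => hu k
    have h0 : 0 ≤ ∑ k ∈ range N, c k * D k := Finset.sum_nonneg fun k _ => hu k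
    have h2 : 0 ≤ 2 * (B : ℝ) * ∑ k ∈ range N, c k * E k := by positivity
    nlinarith
  · obtain ⟨M, rfl⟩ := Nat.exists_eq_add_of_le' hBN
    have hsplit : ∑ k ∈ range (M + B), c k * D k = U + ∑ k ∈ range M, c (k + B) * D (k + B) := by
      rw [add_comm M B, Finset.sum_range_add]
      simp_rw [add_comm B]
      rfl
    have hsub : ∑ k ∈ range M, c k * D k ≤ ∑ k ∈ range (M + B), c k * D k :=
      Finset.sum_le_sum_of_subset_of_nonneg (Finset.range_mono (by omega)) fun k _ _ => hu k
    have hpert : ∑ k ∈ range M, ∑ r ∈ range B, c (k + r) * E (k + r) ≤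
        B * ∑ k ∈ range (M + B), c k * E k := by
      rw [Finset.sum_comm, ← nsmul_eq_mul]
      refine (Finset.sum_le_card_nsmul _ _ _ fun r hr => ?_).trans_eq (by rw [Finset.card_range])
      have hr' := Finset.mem_range.1 hr
      calc ∑ k ∈ range M, c (k + r) * E (k + r)
          ≤ ∑ k ∈ range r, c k * E k + ∑ k ∈ range M, c (r + k) * E (r + k) := by
            simp_rw [add_comm r]
            exact le_add_of_nonneg_left (Finset.sum_nonneg fun k _ => hw k)
        _ = ∑ k ∈ range (r + M), c k * E k := (Finset.sum_range_add _ _ _).symm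
        _ ≤ _ := Finset.sum_le_sum_of_subset_of_nonneg (Finset.range_mono (by omega))
              fun k _ _ => hw k
    have hsum := Finset.sum_le_sum fun k (_ : k ∈ range M) => hstep k
    rw [Finset.sum_add_distrib, ← Finset.mul_sum, ← Finset.mul_sum] at hsum
    have hmul := mul_le_mul_of_nonneg_left hsub (sub_nonneg.2 hδ1)
    linarith

/-- The small-gain step: if the squared perturbations are controlled by a weighted sum which is
itself controlled by the perturbations, then the weighted sums are summable. -/
lemma summable_of_small_gain {c E Q u : ℕ → ℝ} (hu : ∀ k, 0 ≤ u k)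
    (hc : Summable fun k => c k ^ 2) {M C₁ C₂ V K : ℝ} (hM : 0 ≤ M) (hC₂ : 0 ≤ C₂)
    (hK : 0 ≤ K) (hEQ : ∀ k, E k ^ 2 ≤ M * Q k)
    (hsum : ∀ N, ∑ k ∈ range N, u k ≤ C₁ + C₂ * ∑ k ∈ range N, c k * E k)
    (hQ : ∀ N, ∑ k ∈ range N, Q k ≤ V + K * ∑ k ∈ range N, u k) :
    Summable u := by
  set S : ℝ := ∑' k, c k ^ 2
  set G : ℝ := C₂ * K * M
  have hG : 0 ≤ G := by positivity
  refine summable_of_sum_range_le (c := 2 * (C₁ + C₂ * ((G + 1) * S) + C₂ * M * |V|)) hu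
    fun N => ?_
  have hamgm (k : ℕ) : c k * E k ≤ (G + 1) * c k ^ 2 + M * Q k / (2 * (G + 1)) := by
    have h1 : c k * E k ≤ (G + 1) * c k ^ 2 + E k ^ 2 / (2 * (G + 1)) := by
      rw [← sub_nonneg]
      have : (G + 1) * c k ^ 2 + E k ^ 2 / (2 * (G + 1)) - c k * E k =
        ((G + 1) ^ 2 * c k ^ 2 + ((G + 1) * c k - E k) ^ 2) / (2 * (G + 1)) := by
        field_simp
        ring
      rw [this]
      positivity
    exact h1.trans (by gcongr; exact hEQ k)
  have hsq : ∑ k ∈ range N, c k ^ 2 ≤ S := hc.sum_le_tsum _ fun _ _ => sq_nonneg _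
  have hcE : ∑ k ∈ range N, c k * E k ≤
      (G + 1) * S + M * (|V| + K * ∑ k ∈ range N, u k) / (2 * (G + 1)) := by
    calc _ ≤ ∑ k ∈ range N, ((G + 1) * c k ^ 2 + M * Q k / (2 * (G + 1))) :=
          Finset.sum_le_sum fun k _ => hamgm k
      _ = (G + 1) * ∑ k ∈ range N, c k ^ 2 + M * (∑ k ∈ range N, Q k) / (2 * (G + 1)) := by
          rw [Finset.sum_add_distrib, ← Finset.mul_sum, ← Finset.sum_div, ← Finset.mul_sum]
      _ ≤ _ := by
          gcongr
          exact (hQ N).trans (by gcongr; exact le_abs_self V)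
  set W := ∑ k ∈ range N, u k
  have hW : 0 ≤ W := Finset.sum_nonneg fun k _ => hu k
  have h1 : C₂ * (M * (|V| + K * W) / (2 * (G + 1))) ≤ C₂ * M * |V| + W / 2 := by
    rw [← mul_div_assoc, div_le_iff₀ (by positivity)]
    have e1 : C₂ * (M * (|V| + K * W)) = C₂ * M * |V| + G * W := by simp only [G]; ring
    have h2 : 0 ≤ C₂ * M * |V| := by positivity
    rw [e1]
    nlinarith [mul_nonneg hG h2]
  have h2 := (hsum N).trans (add_le_add_right (mul_le_mul_of_nonneg_left hcE hC₂) C₁)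
  rw [mul_add] at h2
  linarith

section Proximal

variable {E : Type*} [NormedAddCommGroup E] [InnerProductSpace ℝ E]

/-- The three-point inequality for a proximal step over a convex set. -/
lemma proximal_three_point {s : Set E} {f : E → ℝ} (hf : ConvexOn ℝ s f) {c : ℝ} (hc : 0 < c)
    {p z : E} (hp : p ∈ s)
    (hmin : ∀ y ∈ s, f p + (1 / (2 * c)) * ‖z - p‖ ^ 2 ≤ f y + (1 / (2 * c)) * ‖z - y‖ ^ 2)
    {y : E} (hy : y ∈ s) :
    ‖z - p‖ ^ 2 + ‖p - y‖ ^ 2 ≤ ‖z - y‖ ^ 2 + 2 * c * (f y - f p) := by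
  have key (t : ℝ) (ht0 : 0 < t) (ht1 : t < 1) :
      (1 - t) * ‖p - y‖ ^ 2 ≤ ‖z - y‖ ^ 2 - ‖z - p‖ ^ 2 + 2 * c * (f y - f p) := by
    have ht1' : 0 ≤ 1 - t := by linarith
    have hmem := hf.1 hp hy ht1' ht0.le (by ring)
    have hconv := hf.2 hp hy ht1' ht0.le (by ring)
    have hm := hmin _ hmem
    have hnorm : ‖z - ((1 - t) • p + t • y)‖ ^ 2 =
        (1 - t) * ‖z - p‖ ^ 2 + t * ‖z - y‖ ^ 2 - t * (1 - t) * ‖p - y‖ ^ 2 := by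
      have e1 : z - ((1 - t) • p + t • y) = (1 - t) • (z - p) + t • (z - y) := by module
      have e2 : p - y = (z - y) - (z - p) := by abel
      rw [e1, e2, norm_add_sq_real, norm_sub_sq_real (z - y) (z - p), norm_smul, norm_smul,
        inner_smul_left, inner_smul_right, Real.norm_of_nonneg ht1', Real.norm_of_nonneg ht0.le]
      simp only [conj_trivial, real_inner_comm (z - y) (z - p)]
      ring
    rw [hnorm] at hm
    simp only [smul_eq_mul] at hconv
    have hm2 : 2 * c * f p + ‖z - p‖ ^ 2 ≤ 2 * c * ((1 - t) * f p + t * f y) +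
        ((1 - t) * ‖z - p‖ ^ 2 + t * ‖z - y‖ ^ 2 - t * (1 - t) * ‖p - y‖ ^ 2) := by
      have := mul_le_mul_of_nonneg_left (hm.trans (add_le_add_left hconv _))
        (by positivity : (0 : ℝ) ≤ 2 * c)
      simp only [mul_add (2 * c), ← mul_assoc, mul_one_div_cancel (by positivity : 2 * c ≠ 0),
        one_mul] at this ⊢
      linarith
    refine le_of_mul_le_mul_left ?_ ht0
    linarith
  have hlim : Tendsto (fun t : ℝ => (1 - t) * ‖p - y‖ ^ 2) (𝓝[>] 0) (𝓝 (‖p - y‖ ^ 2)) := by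
    have : Continuous fun t : ℝ => (1 - t) * ‖p - y‖ ^ 2 := by fun_prop
    simpa using (this.tendsto 0).mono_left nhdsWithin_le_nhds
  have := le_of_tendsto hlim (by
    filter_upwards [Ioo_mem_nhdsGT (zero_lt_one' ℝ)] with t ht using key t ht.1 ht.2)
  linarith

lemma sum_norm_mixing_sub_sq_le {ι : Type*} [Fintype ι] [DecidableEq ι] {P : Matrix ι ι ℝ}
    (hP : P ∈ doublyStochastic ℝ ι) (y : ι → E) (w : E) :
    ∑ i, ‖mixing P y i - w‖ ^ 2 ≤ ∑ i, ‖y i - w‖ ^ 2 := by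
  have hconv : ConvexOn ℝ Set.univ fun u : E => ‖u‖ ^ 2 :=
    (convexOn_norm convex_univ).pow (fun _ _ => norm_nonneg _) 2
  have h (i : ι) : ‖mixing P y i - w‖ ^ 2 ≤ ∑ j, P i j * ‖y j - w‖ ^ 2 := by
    have e : mixing P y i - w = ∑ j, P i j • (y j - w) := by
      simp_rw [smul_sub, Finset.sum_sub_distrib, ← Finset.sum_smul,
        sum_row_of_mem_doublyStochastic hP, one_smul]
      rfl
    rw [e]
    exact hconv.map_sum_le (fun j _ => nonneg_of_mem_doublyStochastic hP)
      (sum_row_of_mem_doublyStochastic hP i) (fun _ _ => Set.mem_univ _)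
  refine (Finset.sum_le_sum fun i _ => h i).trans_eq ?_
  rw [Finset.sum_comm]
  simp_rw [← Finset.sum_mul, sum_col_of_mem_doublyStochastic hP, one_mul]

/-- Moving a point towards the center of a ball contained in `s`, by an amount governed by its
distance to `s`, brings it into `s`. -/
lemma combination_mem_of_infDist_le {s : Set E} (hs : IsCompact s) (hconv : Convex ℝ s) {x₀ : E}
    {ρ : ℝ} (hρ : 0 < ρ) (hball : ball x₀ ρ ⊆ s) {v : E} {ε : ℝ} (hε : infDist v s ≤ ε) :
    (ε / (ε + ρ)) • x₀ + (ρ / (ε + ρ)) • v ∈ s := by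
  obtain ⟨p, hp, hvp⟩ := hs.exists_infDist_eq_dist ⟨x₀, hball (mem_ball_self hρ)⟩ v
  rw [hvp, dist_eq_norm] at hε
  rcases ((norm_nonneg _).trans hε).eq_or_lt with rfl | hpos
  · have : v = p := sub_eq_zero.1 (norm_le_zero_iff.1 hε)
    simpa [this, hρ.ne'] using hp
  · have hcb : closedBall x₀ ρ ⊆ s := by
      rw [← closure_ball x₀ hρ.ne']
      exact closure_minimal hball hs.isClosed
    have hq : x₀ + (ρ / ε) • (v - p) ∈ s := by
      refine hcb ?_
      rw [mem_closedBall, dist_eq_norm, add_sub_cancel_left, norm_smul,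
        Real.norm_of_nonneg (by positivity), div_mul_eq_mul_div, div_le_iff₀ hpos]
      gcongr
    have hmem := hconv hq hp (a := ε / (ε + ρ)) (b := ρ / (ε + ρ)) (by positivity) (by positivity)
      (by rw [← add_div, div_self (by positivity)])
    convert hmem using 1
    rw [smul_add, smul_smul, show ε / (ε + ρ) * (ρ / ε) = ρ / (ε + ρ) by field_simp]
    module

end Proximal

theorem stmt10
    (n m : ℕ) (hm : 2 ≤ m)
    (X : Fin m → Set (EuclideanSpace ℝ (Fin n)))
    (hXne : ∀ i, (X i).Nonempty)
    (hXcpt : ∀ i, IsCompact (X i))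
    (hXconv : ∀ i, Convex ℝ (X i))
    (f : Fin m → EuclideanSpace ℝ (Fin n) → ℝ)
    (hfconv : ∀ i, ConvexOn ℝ Set.univ (f i))
    (Lbar : ℝ) (hLbar : 0 < Lbar)
    (hLip : ∀ i, ∀ p₁ ∈ X i, ∀ p₂ ∈ X i, |f i p₁ - f i p₂| ≤ Lbar * ‖p₁ - p₂‖)
    (xbar : EuclideanSpace ℝ (Fin n)) (ρ : ℝ) (hρ : 0 < ρ)
    (hball : Metric.ball xbar ρ ⊆ ⋂ i, X i)
    (a : ℕ → Fin m → Fin m → ℝ)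
    (ha_nonneg : ∀ k i j, 0 ≤ a k i j)
    (ha_row : ∀ k i, ∑ j, a k i j = 1)
    (ha_col : ∀ k j, ∑ i, a k i j = 1)
    (η : ℝ) (hη : η ∈ Set.Ioo (0:ℝ) 1)
    (ha_diag : ∀ k i, η ≤ a k i i)
    (ha_eta : ∀ k i j, 0 < a k i j → η ≤ a k i j)
    (hconn : ∀ u v : Fin m,
      Relation.ReflTransGen (fun p1 p2 => {k : ℕ | 0 < a k p2 p1}.Infinite) u v)
    (T : ℕ) (hT : 1 ≤ T)
    (hTcomm : ∀ j i : Fin m, {k : ℕ | 0 < a k i j}.Infinite →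
      ∀ k : ℕ, ∃ l, k ≤ l ∧ l < k + T ∧ 0 < a l i j)
    (c : ℕ → ℝ) (hc_pos : ∀ k, 0 < c k) (hc_anti : Antitone c)
    (hc_div : Tendsto (fun N => ∑ k ∈ Finset.range N, c k) atTop atTop)
    (hc_sq : Summable (fun k => (c k)^2))
    (x : Fin m → ℕ → EuclideanSpace ℝ (Fin n))
    (hx0 : ∀ i, x i 0 ∈ X i)
    (z : Fin m → ℕ → EuclideanSpace ℝ (Fin n))
    (hz : ∀ i k, z i k = ∑ j, a k i j • x j k)
    (hupd_mem : ∀ i k, x i (k+1) ∈ X i)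
    (hupd_min : ∀ i k, ∀ y ∈ X i,
      f i (x i (k+1)) + (1/(2 * c k)) * ‖z i k - x i (k+1)‖^2
        ≤ f i y + (1/(2 * c k)) * ‖z i k - y‖^2)
    (hupd_uniq : ∀ i k, ∀ y ∈ X i,
      f i y + (1/(2 * c k)) * ‖z i k - y‖^2
        = f i (x i (k+1)) + (1/(2 * c k)) * ‖z i k - x i (k+1)‖^2 → y = x i (k+1))
    (v : ℕ → EuclideanSpace ℝ (Fin n))
    (hv : ∀ k, v k = (m : ℝ)⁻¹ • ∑ i, x i k)
    (eps : ℕ → ℝ)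
    (heps : ∀ k, eps k = ∑ i, Metric.infDist (v k) (X i))
    (vbar : ℕ → EuclideanSpace ℝ (Fin n))
    (hvbar : ∀ k, vbar k = (eps k / (eps k + ρ)) • xbar + (ρ / (eps k + ρ)) • v k)
    :
    Summable (fun k : ℕ => 2 * Lbar * (c k * ∑ i, ‖x i (k + 1) - vbar (k + 1)‖)) := by
  have hm0 : (0 : ℝ) < m := by exact_mod_cast (by omega : 0 < m)
  have : Nonempty (Fin m) := ⟨⟨0, by omega⟩⟩
  have hη0 : 0 < η := hη.1
  let A : ℕ → Matrix (Fin m) (Fin m) ℝ := fun k => Matrix.of (a k)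
  let y : ℕ → Fin m → EuclideanSpace ℝ (Fin n) := fun k i => x i k
  let e : ℕ → Fin m → EuclideanSpace ℝ (Fin n) := fun k i => x i (k + 1) - z i k
  let D : ℕ → ℝ := fun k => disagreement (y k)
  let E : ℕ → ℝ := fun k => ∑ i, ‖e k i‖
  have hA (k : ℕ) : A k ∈ doublyStochastic ℝ (Fin m) :=
    mem_doublyStochastic_iff_sum.2 ⟨ha_nonneg k, ha_row k, ha_col k⟩
  have hzmix (i : Fin m) (k : ℕ) : z i k = mixing (A k) (y k) i := hz i k
  have hy (k : ℕ) : y (k + 1) = mixing (A k) (y k) + e k := by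
    funext i
    simp only [Pi.add_apply, ← hzmix, y, e]
    abel
  have hxX (i : Fin m) (k : ℕ) : x i k ∈ X i := by
    cases k with
    | zero => exact hx0 i
    | succ k => exact hupd_mem i k
  have hDnn (k : ℕ) : 0 ≤ D k := disagreement_nonneg _
  have hEnn (k : ℕ) : 0 ≤ E k := Finset.sum_nonneg fun _ _ => norm_nonneg _
  have hD_eq (k : ℕ) : D k = ∑ i, ‖x i k - v k‖ := by
    simp [D, y, disagreement, hv]
  have hD_succ (k : ℕ) : D (k + 1) ≤ D k + 2 * E k := by
    change disagreement (y (k + 1)) ≤ _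
    rw [hy]
    exact (disagreement_add_le _ _).trans (add_le_add (disagreement_mixing_le_self (hA k) _)
      (disagreement_le_two_mul_sum_norm _))
  -- The weighted disagreement is controlled by the weighted proximal steps.
  obtain ⟨B, hB⟩ := exists_forall_pow_le_transitionMatrix hA hη0.le ha_diag hconn
    (T := T) fun j i hji k => by
      obtain ⟨l, hl, hlT, hpos⟩ := hTcomm j i hji k
      exact ⟨l, hl, hlT, ha_eta _ _ _ hpos⟩
  have hwindow (k : ℕ) :
      D (k + B) ≤ (1 - η ^ B) * D k + 2 * ∑ r ∈ range B, E (k + r) := by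
    refine (disagreement_perturbed_le hA hy k B).trans ?_
    gcongr
    refine (disagreement_mixing_le (transitionMatrix_mem hA k B) (hB k) _).trans ?_
    refine mul_le_mul_of_nonneg_right ?_ (hDnn k)
    rw [Fintype.card_fin]
    have h1 : (1 : ℝ) ≤ m := by exact_mod_cast (by omega : 1 ≤ m)
    nlinarith [pow_pos hη0 B]
  obtain ⟨C₁, C₂, hC₂, hcD⟩ := exists_sum_mul_le_of_window_contraction hc_anti
    (fun k => (hc_pos k).le) hDnn hEnn (pow_pos hη0 B) (pow_le_one₀ hη0.le hη.2.le) hwindow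
  -- The auxiliary points are feasible and their distance is governed by the disagreement.
  have hballX (i : Fin m) : ball xbar ρ ⊆ X i := hball.trans (Set.iInter_subset X i)
  have heps_nn (k : ℕ) : 0 ≤ eps k := by
    rw [heps]
    exact Finset.sum_nonneg fun _ _ => infDist_nonneg
  have hvbarX (k : ℕ) (i : Fin m) : vbar k ∈ X i := by
    rw [hvbar]
    refine combination_mem_of_infDist_le (hXcpt i) (hXconv i) hρ (hballX i) ?_
    rw [heps]
    exact Finset.single_le_sum (f := fun i => infDist (v k) (X i)) (fun _ _ => infDist_nonneg)
      (Finset.mem_univ i)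
  have heps_le (k : ℕ) : eps k ≤ D k := by
    rw [heps, hD_eq]
    refine Finset.sum_le_sum fun i _ => (infDist_le_dist_of_mem (hxX i k)).trans_eq ?_
    rw [dist_comm, dist_eq_norm]
  obtain ⟨R, hR0, hR⟩ : ∃ R, 0 ≤ R ∧ ∀ k, ‖v k - xbar‖ ≤ R := by
    obtain ⟨R, hR⟩ := ((isCompact_iUnion hXcpt).isBounded).subset_closedBall xbar
    have hxR (i : Fin m) (k : ℕ) : x i k ∈ closedBall xbar R :=
      hR (Set.mem_iUnion.2 ⟨i, hxX i k⟩)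
    have hvR (k : ℕ) : v k ∈ closedBall xbar R := by
      rw [hv, Finset.smul_sum]
      refine (convex_closedBall xbar R).sum_mem (fun _ _ => by positivity) ?_ fun i _ => hxR i k
      simp [hm0.ne']
    have hvR' (k : ℕ) : ‖v k - xbar‖ ≤ R := by simpa [dist_eq_norm] using hvR k
    exact ⟨R, (norm_nonneg _).trans (hvR' 0), hvR'⟩
  set μ : ℝ := 1 + m * (R / ρ) with hμ
  have hμ0 : 0 ≤ μ := by positivity
  let G : ℕ → ℝ := fun k => ∑ i, ‖x i k - vbar k‖
  have hGnn (k : ℕ) : 0 ≤ G k := Finset.sum_nonneg fun _ _ => norm_nonneg _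
  have hv_vbar (k : ℕ) : ‖v k - vbar k‖ ≤ R / ρ * D k := by
    have hden : 0 < eps k + ρ := by linarith [heps_nn k]
    have heq : v k - vbar k = (eps k / (eps k + ρ)) • (v k - xbar) := by
      have h1 : ρ / (eps k + ρ) = 1 - eps k / (eps k + ρ) := by
        field_simp
        ring
      rw [hvbar, h1]
      module
    rw [heq, norm_smul, Real.norm_of_nonneg (div_nonneg (heps_nn k) hden.le)]
    calc eps k / (eps k + ρ) * ‖v k - xbar‖ ≤ D k / ρ * R :=
          mul_le_mul (div_le_div₀ (hDnn k) (heps_le k) hρ (by linarith [heps_nn k])) (hR k)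
            (norm_nonneg _) (div_nonneg (hDnn k) hρ.le)
      _ = R / ρ * D k := by ring
  have hG_le (k : ℕ) : G k ≤ μ * D k := by
    calc G k ≤ ∑ i, (‖x i k - v k‖ + R / ρ * D k) := by
          refine Finset.sum_le_sum fun i _ => ?_
          rw [← sub_add_sub_cancel (x i k) (v k) (vbar k)]
          exact (norm_add_le _ _).trans (by gcongr; exact hv_vbar k)
      _ = μ * D k := by
          rw [Finset.sum_add_distrib, ← hD_eq, Finset.sum_const, Finset.card_univ,
            Fintype.card_fin, nsmul_eq_mul, hμ]
          ring
  -- A constrained minimizer of the total cost exists.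
  obtain ⟨xs, hxs, hxs_min⟩ : ∃ xs ∈ ⋂ i, X i, IsMinOn (fun p => ∑ i, f i p) (⋂ i, X i) xs := by
    have hcpt : IsCompact (⋂ i, X i) := (hXcpt (Classical.arbitrary _)).of_isClosed_subset
      (isClosed_iInter fun i => (hXcpt i).isClosed) (Set.iInter_subset X _)
    refine hcpt.exists_isMinOn ⟨xbar, hball (mem_ball_self hρ)⟩ ?_
    refine continuousOn_finsetSum _ fun i _ => ?_
    have : LipschitzOnWith ⟨Lbar, hLbar.le⟩ (f i) (X i) :=
      LipschitzOnWith.of_dist_le_mul fun p hp q hq => by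
        rw [Real.dist_eq, dist_eq_norm]
        exact hLip i p hp q hq
    exact this.continuousOn.mono (Set.iInter_subset X i)
  have hxsX (i : Fin m) : xs ∈ X i := Set.mem_iInter.1 hxs i
  let V : ℕ → ℝ := fun k => ∑ i, ‖x i k - xs‖ ^ 2
  let Q : ℕ → ℝ := fun k => ∑ i, ‖e k i‖ ^ 2
  have hdescent (k : ℕ) : Q k + V (k + 1) ≤ V k + 2 * Lbar * (c k * G (k + 1)) := by
    have hthree (i : Fin m) : ‖e k i‖ ^ 2 + ‖x i (k + 1) - xs‖ ^ 2 ≤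
        ‖z i k - xs‖ ^ 2 + 2 * c k * (f i xs - f i (vbar (k + 1)) +
          Lbar * ‖x i (k + 1) - vbar (k + 1)‖) := by
      have h1 := proximal_three_point ((hfconv i).subset (Set.subset_univ _) (hXconv i))
        (hc_pos k) (hupd_mem i k) (hupd_min i k) (hxsX i)
      rw [norm_sub_rev (z i k) (x i (k + 1))] at h1
      refine h1.trans ?_
      have h2 := (abs_le.1 (hLip i _ (hupd_mem i k) _ (hvbarX (k + 1) i))).1
      have := (hc_pos k).le
      gcongr
      linarith
    have hopt : ∑ i, f i xs ≤ ∑ i, f i (vbar (k + 1)) :=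
      hxs_min (Set.mem_iInter.2 fun i => hvbarX (k + 1) i)
    have hmixV : ∑ i, ‖z i k - xs‖ ^ 2 ≤ V k := by
      simp_rw [hzmix]
      exact sum_norm_mixing_sub_sq_le (hA k) (y k) xs
    have hsum := Finset.sum_le_sum fun i (_ : i ∈ Finset.univ) => hthree i
    rw [Finset.sum_add_distrib, Finset.sum_add_distrib, ← Finset.mul_sum, Finset.sum_add_distrib,
      Finset.sum_sub_distrib, ← Finset.mul_sum] at hsum
    have hgap := mul_nonneg (hc_pos k).le (sub_nonneg.2 hopt)
    calc Q k + V (k + 1) ≤ _ := hsum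
      _ ≤ V k + 2 * Lbar * (c k * G (k + 1)) := by
        simp only [G]
        linarith
  have hQ_sum (N : ℕ) : ∑ k ∈ range N, Q k + V N ≤
      V 0 + 2 * Lbar * ∑ k ∈ range N, c k * G (k + 1) := by
    induction N with
    | zero => simp
    | succ N ih =>
      rw [Finset.sum_range_succ, Finset.sum_range_succ, mul_add]
      linarith [hdescent N]
  refine Summable.mul_left _ (summable_of_small_gain (c := c) (E := E) (Q := Q) (M := m)
    (C₁ := μ * C₁) (C₂ := μ * (C₂ + 2)) (V := V 0) (K := 2 * Lbar)
    (fun k => mul_nonneg (hc_pos k).le (hGnn (k + 1))) hc_sq hm0.le (by positivity)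
    (by positivity) (fun k => ?_) (fun N => ?_) fun N => ?_)
  · simpa using sq_sum_le_card_mul_sum_sq (s := Finset.univ) (f := fun i => ‖e k i‖)
  · calc ∑ k ∈ range N, c k * G (k + 1)
        ≤ ∑ k ∈ range N, μ * (c k * D k + 2 * (c k * E k)) := by
          refine Finset.sum_le_sum fun k _ => ?_
          calc c k * G (k + 1) ≤ c k * (μ * (D k + 2 * E k)) :=
                mul_le_mul_of_nonneg_left ((hG_le (k + 1)).trans
                  (mul_le_mul_of_nonneg_left (hD_succ k) hμ0)) (hc_pos k).le
            _ = _ := by ring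
      _ = μ * (∑ k ∈ range N, c k * D k + 2 * ∑ k ∈ range N, c k * E k) := by
          rw [← Finset.mul_sum, Finset.sum_add_distrib, ← Finset.mul_sum]
      _ ≤ μ * (C₁ + C₂ * ∑ k ∈ range N, c k * E k + 2 * ∑ k ∈ range N, c k * E k) := by
          gcongr
          exact hcD N
      _ = _ := by ring
  · have hV : 0 ≤ V N := Finset.sum_nonneg fun _ _ => sq_nonneg _
    exact (le_add_of_nonneg_right hV).trans (hQ_sum N)
end

section
/- Fix any α₁ ∈ (0,1). Under the full assumptions and Algorithm 1, for every N ≥ 1 and every minimizer x* ∈ X*: (1 − α₁) ∑_{k=1}^N ∑_{i=1}^m ‖e_i(k+1)‖² ≤ ∑_{i=1}^m ‖x_i(1) − x*‖² + α₂ ∑_{k=1}^N c(k)² + α₃, where α₂ = (2/α₁) m μ² L̄² (m² λ² /(1−q)² + 4) and α₃ = 2 m³ μ² λ² L̄² c(0)² /(α₁ (1−q)²) + 2 m² μ λ L̄ D c(1) q/(1−q) + 2 α₁ m D². -/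
open Filter Finset Metric
open scoped Topology BigOperators

/-- The product `A (s + t - 1) * ⋯ * A s` of `t` consecutive matrices. -/
def transition {m : ℕ} (a : ℕ → Fin m → Fin m → ℝ) (s : ℕ) : ℕ → Fin m → Fin m → ℝ
  | 0 => fun i j => if i = j then 1 else 0
  | t + 1 => fun i j => ∑ l, a (s + t) i l * transition a s t l j

section Transition

variable {m : ℕ} {a : ℕ → Fin m → Fin m → ℝ}

theorem transition_add (s t u : ℕ) (i j : Fin m) :
    transition a s (t + u) i j = ∑ l, transition a (s + t) u i l * transition a s t l j := by
  induction u generalizing i with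
  | zero => simp [transition]
  | succ u ih =>
    rw [← add_assoc]
    simp only [transition, ih, Finset.sum_mul, Finset.mul_sum, add_assoc, mul_assoc]
    exact Finset.sum_comm

theorem transition_nonneg (ha : ∀ k i j, 0 ≤ a k i j) (s t : ℕ) (i j : Fin m) :
    0 ≤ transition a s t i j := by
  induction t generalizing i with
  | zero => simp only [transition]; split_ifs <;> norm_num
  | succ t ih => exact Finset.sum_nonneg fun l _ => mul_nonneg (ha _ _ _) (ih l)

theorem transition_row_sum (ha : ∀ k i, ∑ j, a k i j = 1) (s t : ℕ) (i : Fin m) :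
    ∑ j, transition a s t i j = 1 := by
  induction t generalizing i with
  | zero => simp [transition]
  | succ t ih =>
    simp only [transition]
    rw [Finset.sum_comm]
    simp [← Finset.mul_sum, ih, ha]

theorem transition_col_sum (ha : ∀ k j, ∑ i, a k i j = 1) (s t : ℕ) (j : Fin m) :
    ∑ i, transition a s t i j = 1 := by
  induction t with
  | zero => simp [transition]
  | succ t ih =>
    simp only [transition]
    rw [Finset.sum_comm]
    simp [← Finset.sum_mul, ih, ha]

theorem pow_succ_le_transition_succ (ha : ∀ k i j, 0 ≤ a k i j) {η : ℝ} (hη : 0 ≤ η)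
    {s t : ℕ} {i l j : Fin m} (hl : η ^ t ≤ transition a s t l j) (hil : η ≤ a (s + t) i l) :
    η ^ (t + 1) ≤ transition a s (t + 1) i j := by
  calc η ^ (t + 1) = η * η ^ t := by ring
    _ ≤ a (s + t) i l * transition a s t l j :=
        mul_le_mul hil hl (by positivity) (ha _ _ _)
    _ ≤ _ := Finset.single_le_sum (f := fun l => a (s + t) i l * transition a s t l j)
        (fun l _ => mul_nonneg (ha _ _ _) (transition_nonneg ha _ _ _ _)) (Finset.mem_univ l)

theorem pow_le_transition_mono (ha : ∀ k i j, 0 ≤ a k i j) {η : ℝ} (hη : 0 ≤ η)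
    (hdiag : ∀ k i, η ≤ a k i i) {s t : ℕ} {i j : Fin m} (h : η ^ t ≤ transition a s t i j)
    {t' : ℕ} (ht : t ≤ t') : η ^ t' ≤ transition a s t' i j := by
  induction t', ht using Nat.le_induction with
  | base => exact h
  | succ t' _ ih => exact pow_succ_le_transition_succ ha hη ih (hdiag _ _)

/-- A set which contains the start of a path, but not its end, is left along some edge. -/
theorem exists_edge_leaving {V : Type*} {r : V → V → Prop} {S : Set V} {u v : V}
    (h : Relation.ReflTransGen r u v) (hu : u ∈ S) (hv : v ∉ S) :
    ∃ p p', r p p' ∧ p ∈ S ∧ p' ∉ S := by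
  induction h with
  | refl => exact absurd hu hv
  | @tail b d _ hbd ih =>
    by_cases hb : b ∈ S
    · exact ⟨b, d, hbd, hb, hv⟩
    · exact ih hb

theorem card_le_reached (ha : ∀ k i j, 0 ≤ a k i j) {η : ℝ} (hη : 0 ≤ η)
    (hdiag : ∀ k i, η ≤ a k i i) (heta : ∀ k i j, 0 < a k i j → η ≤ a k i j)
    (hconn : ∀ u v : Fin m,
      Relation.ReflTransGen (fun p1 p2 => {k : ℕ | 0 < a k p2 p1}.Infinite) u v)
    {T : ℕ} (hT : ∀ j i : Fin m, {k : ℕ | 0 < a k i j}.Infinite →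
      ∀ k : ℕ, ∃ l, k ≤ l ∧ l < k + T ∧ 0 < a l i j) (s : ℕ) (j : Fin m) (p : ℕ) :
    min (p + 1) m ≤ #{i | η ^ (p * T) ≤ transition a s (p * T) i j} := by
  induction p with
  | zero =>
    refine le_trans (min_le_left _ _) (Finset.card_pos.2 ⟨j, ?_⟩)
    simp [transition]
  | succ p ih =>
    set R := ({i | η ^ (p * T) ≤ transition a s (p * T) i j} : Finset (Fin m)) with hR
    set R' := ({i | η ^ ((p + 1) * T) ≤ transition a s ((p + 1) * T) i j} : Finset (Fin m))
      with hR'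
    have hle : p * T ≤ (p + 1) * T := Nat.mul_le_mul_right _ (Nat.le_succ _)
    have hsub : R ⊆ R' := by
      intro i hi
      simp only [hR, hR', Finset.mem_filter, Finset.mem_univ, true_and] at hi ⊢
      exact pow_le_transition_mono ha hη hdiag hi hle
    by_cases hfull : ∀ i, i ∈ R
    · have : R' = Finset.univ := Finset.eq_univ_of_forall fun i => hsub (hfull i)
      rw [this]
      simp
    · push Not at hfull
      obtain ⟨v, hv⟩ := hfull
      have hj : j ∈ R := by
        simp only [hR, Finset.mem_filter, Finset.mem_univ, true_and]
        exact pow_le_transition_mono ha hη hdiag (t := 0) (by simp [transition]) (Nat.zero_le _)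
      obtain ⟨u, w, huw, hu, hw⟩ :=
        exists_edge_leaving (S := (R : Set (Fin m))) (hconn j v) (by simpa using hj)
          (by simpa using hv)
      obtain ⟨l, hl₁, hl₂, hl⟩ := hT u w huw (s + p * T)
      obtain ⟨t, rfl⟩ : ∃ t, l = s + t := ⟨l - s, by omega⟩
      have hu' : η ^ (p * T) ≤ transition a s (p * T) u j := by simpa [hR] using hu
      have hwR : w ∈ R' := by
        simp only [hR', Finset.mem_filter, Finset.mem_univ, true_and]
        refine pow_le_transition_mono ha hη hdiag (t := t + 1) ?_ (by rw [add_mul]; omega)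
        exact pow_succ_le_transition_succ ha hη
          (pow_le_transition_mono ha hη hdiag hu' (by omega)) (heta _ _ _ hl)
      have : R ⊂ R' := (Finset.ssubset_iff_of_subset hsub).2 ⟨w, hwR, by simpa using hw⟩
      have := Finset.card_lt_card this
      omega

theorem pow_le_transition (ha : ∀ k i j, 0 ≤ a k i j) {η : ℝ} (hη : 0 ≤ η)
    (hdiag : ∀ k i, η ≤ a k i i) (heta : ∀ k i j, 0 < a k i j → η ≤ a k i j)
    (hconn : ∀ u v : Fin m,
      Relation.ReflTransGen (fun p1 p2 => {k : ℕ | 0 < a k p2 p1}.Infinite) u v)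
    {T : ℕ} (hT : ∀ j i : Fin m, {k : ℕ | 0 < a k i j}.Infinite →
      ∀ k : ℕ, ∃ l, k ≤ l ∧ l < k + T ∧ 0 < a l i j) (s : ℕ) (i j : Fin m) :
    η ^ ((m - 1) * T) ≤ transition a s ((m - 1) * T) i j := by
  have h := card_le_reached ha hη hdiag heta hconn hT s j (m - 1)
  have hm : 0 < m := i.pos
  rw [Nat.sub_add_cancel hm, min_self] at h
  have huniv := (Finset.card_eq_iff_eq_univ _).1
    (le_antisymm (Finset.card_le_univ _) (by rwa [Fintype.card_fin]))
  have hi := Finset.mem_univ i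
  rw [← huniv] at hi
  simpa using hi

/-- Averaging with weights at least `θ` shrinks the spread of a vector by the factor `1 - θ`. -/
theorem exists_spread_averaging {w : Fin m → Fin m → ℝ} {θ : ℝ} (hw : ∀ i j, θ ≤ w i j)
    (hw₀ : ∀ i j, 0 ≤ w i j) (hsum : ∀ i, ∑ j, w i j = 1) {y : Fin m → ℝ} {lo d : ℝ}
    (hy : ∀ i, lo ≤ y i ∧ y i ≤ lo + d) :
    ∃ lo', ∀ i, lo' ≤ ∑ l, w i l * y l ∧ ∑ l, w i l * y l ≤ lo' + (1 - θ) * d := by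
  rcases isEmpty_or_nonempty (Fin m) with hm | ⟨⟨o⟩⟩
  · exact ⟨0, fun i => isEmptyElim i⟩
  refine ⟨θ * y o + (1 - θ) * lo, fun i => ?_⟩
  have key : ∀ e : ℝ, ∑ l, w i l * y l - e
      = w i o * (y o - e) + ∑ l ∈ Finset.univ.erase o, w i l * (y l - e) := by
    intro e
    rw [Finset.add_sum_erase _ (fun l => w i l * (y l - e)) (Finset.mem_univ o)]
    simp only [mul_sub, Finset.sum_sub_distrib, ← Finset.sum_mul, hsum, one_mul]
  constructor
  · have h := key lo
    have h1 : 0 ≤ ∑ l ∈ Finset.univ.erase o, w i l * (y l - lo) :=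
      Finset.sum_nonneg fun l _ => mul_nonneg (hw₀ _ _) (by linarith [(hy l).1])
    nlinarith [mul_le_mul_of_nonneg_right (hw i o) (sub_nonneg.2 (hy o).1)]
  · have h := key (lo + d)
    have h1 : ∑ l ∈ Finset.univ.erase o, w i l * (y l - (lo + d)) ≤ 0 :=
      Finset.sum_nonpos fun l _ =>
        mul_nonpos_of_nonneg_of_nonpos (hw₀ _ _) (by linarith [(hy l).2])
    nlinarith [mul_le_mul_of_nonneg_right (hw i o) (sub_nonneg.2 (hy o).2)]

theorem transition_spread (ha : ∀ k i j, 0 ≤ a k i j) (hrow : ∀ k i, ∑ j, a k i j = 1)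
    {θ : ℝ} {B : ℕ} (hθ : ∀ s i j, θ ≤ transition a s B i j) (s r n : ℕ) (j : Fin m) :
    ∃ lo, ∀ i, lo ≤ transition a s (r + B * n) i j ∧
      transition a s (r + B * n) i j ≤ lo + (1 - θ) ^ n := by
  induction n with
  | zero =>
    refine ⟨0, fun i => ⟨transition_nonneg ha _ _ _ _, ?_⟩⟩
    have := Finset.single_le_sum (f := fun j => transition a s (r + B * 0) i j)
      (fun j _ => transition_nonneg ha _ _ _ _) (Finset.mem_univ j)
    rw [transition_row_sum hrow] at this
    simpa using this
  | succ n ih =>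
    obtain ⟨lo, hlo⟩ := ih
    obtain ⟨lo', h⟩ := exists_spread_averaging (hθ (s + (r + B * n)))
      (transition_nonneg ha _ _) (transition_row_sum hrow _ _) hlo
    refine ⟨lo', fun i => ?_⟩
    rw [mul_add, mul_one, ← add_assoc, transition_add, pow_succ']
    exact h i

theorem abs_transition_sub_le (ha : ∀ k i j, 0 ≤ a k i j) (hrow : ∀ k i, ∑ j, a k i j = 1)
    (hcol : ∀ k j, ∑ i, a k i j = 1) {θ q : ℝ} {B : ℕ} (hB : 0 < B) (hθ₁ : θ < 1)
    (hq₀ : 0 < q) (hq₁ : q ≤ 1) (hq : q ^ B = 1 - θ)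
    (hθ : ∀ s i j, θ ≤ transition a s B i j) (s t : ℕ) (i j : Fin m) :
    |transition a s t i j - 1 / m| ≤ q ^ t / (1 - θ) := by
  obtain ⟨lo, h⟩ := transition_spread ha hrow hθ s (t % B) (t / B) j
  rw [Nat.mod_add_div] at h
  have hm : (0 : ℝ) < m := by exact_mod_cast i.pos
  have hpow : (1 - θ) ^ (t / B) ≤ q ^ t / (1 - θ) := by
    rw [le_div_iff₀ (by linarith), ← hq, ← pow_succ, ← pow_mul]
    refine pow_le_pow_of_le_one hq₀.le hq₁ ?_
    have := Nat.mod_add_div t B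
    have := Nat.mod_lt t hB
    rw [mul_add]
    omega
  have hs := transition_col_sum hcol s t j
  have h1 : m * lo ≤ 1 := by
    have := Finset.sum_le_sum fun i (_ : i ∈ Finset.univ) => (h i).1
    rw [hs] at this
    simpa using this
  have h2 : 1 ≤ m * (lo + (1 - θ) ^ (t / B)) := by
    have := Finset.sum_le_sum fun i (_ : i ∈ Finset.univ) => (h i).2
    rw [hs] at this
    simpa [mul_add] using this
  have h1' : lo ≤ 1 / m := by rw [le_div_iff₀ hm]; linarith
  have h2' : 1 / m ≤ lo + (1 - θ) ^ (t / B) := by rw [div_le_iff₀ hm]; linarith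
  have := h i
  rw [abs_le]
  constructor <;> linarith

variable {E : Type*} [NormedAddCommGroup E] [NormedSpace ℝ E]

theorem eq_transition_sum {x e : Fin m → ℕ → E}
    (h : ∀ i k, x i (k + 1) = (∑ j, a k i j • x j k) + e i k) (i : Fin m) (k : ℕ) :
    x i k = (∑ j, transition a 0 k i j • x j 0) +
      ∑ r ∈ Finset.range k, ∑ j, transition a (r + 1) (k - 1 - r) i j • e j r := by
  induction k generalizing i with
  | zero => simp [transition]
  | succ k ih =>
    rw [h, Finset.sum_range_succ]
    have h1 : ∑ j, transition a (k + 1) (k + 1 - 1 - k) i j • e j k = e i k := by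
      simp [transition, ite_smul]
    have h2 : ∀ r ∈ Finset.range k, ∑ j, transition a (r + 1) (k + 1 - 1 - r) i j • e j r
        = ∑ l, a k i l • ∑ j, transition a (r + 1) (k - 1 - r) l j • e j r := by
      intro r hr
      have hr := Finset.mem_range.1 hr
      have h3 : k + 1 - 1 - r = (k - 1 - r) + 1 := by omega
      have h4 : r + 1 + (k - 1 - r) = k := by omega
      simp only [h3, transition, h4, Finset.sum_smul, Finset.smul_sum, smul_smul]
      exact Finset.sum_comm
    have h5 : ∑ j, transition a 0 (k + 1) i j • x j 0
        = ∑ l, a k i l • ∑ j, transition a 0 k l j • x j 0 := by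
      simp only [transition, zero_add, Finset.sum_smul, Finset.smul_sum, smul_smul]
      exact Finset.sum_comm
    rw [h1, Finset.sum_congr rfl h2, h5, ← add_assoc, Finset.sum_comm, ← Finset.sum_add_distrib]
    congr 1
    refine Finset.sum_congr rfl fun l _ => ?_
    rw [← Finset.smul_sum, ← smul_add, ← ih]

theorem mean_eq_sum {x e : Fin m → ℕ → E} (hcol : ∀ k j, ∑ i, a k i j = 1)
    (h : ∀ i k, x i (k + 1) = (∑ j, a k i j • x j k) + e i k) (k : ℕ) :
    ∑ i, x i k = (∑ j, x j 0) + ∑ r ∈ Finset.range k, ∑ j, e j r := by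
  induction k with
  | zero => simp
  | succ k ih =>
    rw [Finset.sum_range_succ, ← add_assoc, ← ih]
    simp only [h, Finset.sum_add_distrib]
    rw [Finset.sum_comm]
    simp [← Finset.sum_smul, hcol]

theorem norm_sum_smul_sub_le {p : Fin m → ℝ} {b : ℝ} (hp : ∀ j, |p j - 1 / m| ≤ b)
    (y : Fin m → E) :
    ‖(∑ j, p j • y j) - (1 / m : ℝ) • ∑ j, y j‖ ≤ b * ∑ j, ‖y j‖ := by
  rw [Finset.smul_sum, ← Finset.sum_sub_distrib, Finset.mul_sum]
  refine (norm_sum_le _ _).trans (Finset.sum_le_sum fun j _ => ?_)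
  rw [← sub_smul, norm_smul]
  exact mul_le_mul_of_nonneg_right (hp j) (norm_nonneg _)

/-- Disagreement bound for a perturbed averaging iteration. -/
theorem sum_norm_sub_mean_le (hcol : ∀ k j, ∑ i, a k i j = 1) {lam q : ℝ} (hm : 0 < m)
    (hbound : ∀ s t i j, |transition a s (t + 1) i j - 1 / m| ≤ lam * q ^ t)
    {x e : Fin m → ℕ → E}
    (h : ∀ i k, x i (k + 1) = (∑ j, a k i j • x j k) + e i k) (k : ℕ) :
    ∑ i, ‖x i (k + 1) - (1 / m : ℝ) • ∑ j, x j (k + 1)‖ ≤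
      m * (lam * q ^ k * ∑ j, ‖x j 0‖) + 2 * ∑ j, ‖e j k‖ +
      m * (lam * ∑ r ∈ Finset.range k, q ^ (k - 1 - r) * ∑ j, ‖e j r‖) := by
  have hm' : (0 : ℝ) < m := by exact_mod_cast hm
  have hi : ∀ i, ‖x i (k + 1) - (1 / m : ℝ) • ∑ j, x j (k + 1)‖ ≤
      lam * q ^ k * ∑ j, ‖x j 0‖ + (‖e i k‖ + (1 / m) * ∑ j, ‖e j k‖) +
      lam * ∑ r ∈ Finset.range k, q ^ (k - 1 - r) * ∑ j, ‖e j r‖ := by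
    intro i
    have h1 : ∑ j, transition a (k + 1) (k + 1 - 1 - k) i j • e j k = e i k := by
      simp [transition, ite_smul]
    have hsplit : x i (k + 1) - (1 / m : ℝ) • ∑ j, x j (k + 1) =
        ((∑ j, transition a 0 (k + 1) i j • x j 0) - (1 / m : ℝ) • ∑ j, x j 0) +
        (e i k - (1 / m : ℝ) • ∑ j, e j k) +
        ∑ r ∈ Finset.range k, ((∑ j, transition a (r + 1) (k + 1 - 1 - r) i j • e j r) -
          (1 / m : ℝ) • ∑ j, e j r) := by
      rw [mean_eq_sum hcol h, eq_transition_sum h i (k + 1), Finset.sum_range_succ,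
        Finset.sum_range_succ, h1, Finset.sum_sub_distrib, ← Finset.smul_sum]
      module
    rw [hsplit]
    refine (norm_add₃_le).trans (add_le_add (add_le_add ?_ ?_) ?_)
    · exact norm_sum_smul_sub_le (fun j => hbound 0 k i j) _
    · refine (norm_sub_le _ _).trans (add_le_add le_rfl ?_)
      rw [norm_smul, Real.norm_of_nonneg (by positivity)]
      exact mul_le_mul_of_nonneg_left (norm_sum_le _ _) (by positivity)
    · refine (norm_sum_le _ _).trans ?_
      rw [Finset.mul_sum]
      refine Finset.sum_le_sum fun r hr => ?_
      have hr := Finset.mem_range.1 hr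
      have h3 : k + 1 - 1 - r = (k - 1 - r) + 1 := by omega
      rw [h3, ← mul_assoc]
      exact norm_sum_smul_sub_le (fun j => hbound (r + 1) (k - 1 - r) i j) _
  refine (Finset.sum_le_sum fun i _ => hi i).trans (le_of_eq ?_)
  simp only [Finset.sum_add_distrib, Finset.sum_const, Finset.card_univ, Fintype.card_fin,
    nsmul_eq_mul]
  field_simp
  ring

end Transition

/-- The obtuse angle property of a proximal step. -/
theorem prox_inequality {E : Type*} [NormedAddCommGroup E] [InnerProductSpace ℝ E]
    {X : Set E} (hX : Convex ℝ X) {f : E → ℝ} (hf : ConvexOn ℝ Set.univ f) {c : ℝ} (hc : 0 < c)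
    {z p : E} (hp : p ∈ X)
    (hmin : ∀ y ∈ X, f p + (1 / (2 * c)) * ‖z - p‖ ^ 2 ≤ f y + (1 / (2 * c)) * ‖z - y‖ ^ 2)
    {w : E} (hw : w ∈ X) :
    ‖p - w‖ ^ 2 + ‖p - z‖ ^ 2 + 2 * c * (f p - f w) ≤ ‖z - w‖ ^ 2 := by
  have key : ∀ t : ℝ, 0 < t → t ≤ 1 →
      2 * inner ℝ (z - p) (w - p) ≤ 2 * c * (f w - f p) + t * ‖w - p‖ ^ 2 := by
    intro t ht ht1
    have hy : p + t • (w - p) = (1 - t) • p + t • w := by module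
    have h1 := hmin (p + t • (w - p))
      (by rw [hy]; exact hX hp hw (by linarith) ht.le (by ring))
    have h2 : f (p + t • (w - p)) ≤ (1 - t) * f p + t * f w := by
      rw [hy]
      exact hf.2 (Set.mem_univ _) (Set.mem_univ _) (by linarith) ht.le (by ring)
    have h3 : ‖z - (p + t • (w - p))‖ ^ 2
        = ‖z - p‖ ^ 2 - 2 * t * inner ℝ (z - p) (w - p) + t ^ 2 * ‖w - p‖ ^ 2 := by
      rw [← sub_sub, norm_sub_sq_real, inner_smul_right, norm_smul, Real.norm_of_nonneg ht.le]
      ring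
    rw [h3] at h1
    have h4 : 0 ≤ t * (f w - f p) +
        (1 / (2 * c)) * (- (2 * t * inner ℝ (z - p) (w - p)) + t ^ 2 * ‖w - p‖ ^ 2) := by
      linarith
    have h5 : t * (f w - f p) +
        (1 / (2 * c)) * (- (2 * t * inner ℝ (z - p) (w - p)) + t ^ 2 * ‖w - p‖ ^ 2)
        = t / (2 * c) * (2 * c * (f w - f p) + t * ‖w - p‖ ^ 2
          - 2 * inner ℝ (z - p) (w - p)) := by
      field_simp
      ring
    rw [h5] at h4
    linarith [nonneg_of_mul_nonneg_right h4 (by positivity)]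
  have hlim : 2 * inner ℝ (z - p) (w - p) ≤ 2 * c * (f w - f p) := by
    refine le_of_forall_pos_le_add fun ε hε => ?_
    have hpos : 0 < ‖w - p‖ ^ 2 + 1 := by positivity
    refine (key (min 1 (ε / (‖w - p‖ ^ 2 + 1))) (by positivity) (min_le_left _ _)).trans ?_
    gcongr
    calc min 1 (ε / (‖w - p‖ ^ 2 + 1)) * ‖w - p‖ ^ 2
        ≤ ε / (‖w - p‖ ^ 2 + 1) * (‖w - p‖ ^ 2 + 1) := by
          gcongr
          · exact min_le_right _ _
          · linarith
      _ = ε := by field_simp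
  have h6 : ‖z - w‖ ^ 2
      = ‖z - p‖ ^ 2 - 2 * inner ℝ (z - p) (w - p) + ‖w - p‖ ^ 2 := by
    rw [← norm_sub_sq_real]
    congr 2
    abel
  rw [norm_sub_rev p w, norm_sub_rev p z]
  linarith

theorem norm_sum_smul_sub_sq_le {E : Type*} [NormedAddCommGroup E] [NormedSpace ℝ E]
    {ι : Type*} [Fintype ι] {w : ι → ℝ} (hw : ∀ j, 0 ≤ w j) (hsum : ∑ j, w j = 1)
    (y : ι → E) (p : E) :
    ‖(∑ j, w j • y j) - p‖ ^ 2 ≤ ∑ j, w j * ‖y j - p‖ ^ 2 := by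
  have hconv : ConvexOn ℝ Set.univ fun v : E => ‖v‖ ^ 2 :=
    (convexOn_norm convex_univ).pow (fun _ _ => norm_nonneg _) 2
  have := hconv.map_sum_le (t := Finset.univ) (w := w) (p := fun j => y j - p)
    (fun j _ => hw j) hsum (fun _ _ => Set.mem_univ _)
  simpa [smul_sub, Finset.sum_sub_distrib, ← Finset.sum_smul, hsum] using this

/-- Points of sets which share a ball are close to a common point of these sets. -/
theorem exists_common_point {E : Type*} [NormedAddCommGroup E] [NormedSpace ℝ E] {m : ℕ}
    {X : Fin m → Set E} (hXcl : ∀ i, IsClosed (X i)) (hXconv : ∀ i, Convex ℝ (X i))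
    {xbar : E} {ρ : ℝ} (hρ : 0 < ρ) (hball : Metric.ball xbar ρ ⊆ ⋂ i, X i)
    {D : ℝ} (hxbar : ‖xbar‖ ≤ D) {y : Fin m → E} (hy : ∀ i, y i ∈ X i) {v : E} (hv : ‖v‖ ≤ D) :
    ∃ p ∈ ⋂ i, X i, ∑ i, ‖y i - p‖ ≤ ((2 / ρ) * m * D + 1) * ∑ i, ‖y i - v‖ := by
  set ε := ∑ i, ‖y i - v‖ with hε
  have hε₀ : 0 ≤ ε := Finset.sum_nonneg fun _ _ => norm_nonneg _
  have hle : ∀ i, ‖y i - v‖ ≤ ε := fun i =>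
    Finset.single_le_sum (f := fun i => ‖y i - v‖) (fun _ _ => norm_nonneg _) (Finset.mem_univ i)
  refine ⟨v + (ε / (ε + ρ)) • (xbar - v), Set.mem_iInter.2 fun i => ?_, ?_⟩
  · rcases hε₀.eq_or_lt with h0 | hpos
    · have h1 : y i = v := by
        have := (hle i).trans h0.symm.le
        exact sub_eq_zero.1 (norm_le_zero_iff.1 this)
      rw [← h0, zero_div, zero_smul, add_zero, ← h1]
      exact hy i
    · have hcb : Metric.closedBall xbar ρ ⊆ X i := by
        rw [← closure_ball xbar hρ.ne']
        exact closure_minimal (hball.trans (Set.iInter_subset _ i)) (hXcl i)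
      have hw : xbar + (ρ / ε) • (v - y i) ∈ X i := by
        apply hcb
        rw [mem_closedBall, dist_eq_norm, add_sub_cancel_left, norm_smul,
          Real.norm_of_nonneg (by positivity), norm_sub_rev]
        calc ρ / ε * ‖y i - v‖ ≤ ρ / ε * ε := by gcongr; exact hle i
          _ = ρ := by field_simp
      have hcomb := hXconv i hw (hy i) (a := ε / (ε + ρ)) (b := ρ / (ε + ρ)) (by positivity)
        (by positivity) (by field_simp)
      convert hcomb using 1
      have h1 : ε / (ε + ρ) = 1 - ρ / (ε + ρ) := by field_simp; ring
      have h2 : ε / (ε + ρ) * (ρ / ε) = ρ / (ε + ρ) := by field_simp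
      rw [smul_add, smul_smul, h2, h1]
      module
  · have hd : ‖(ε / (ε + ρ)) • (xbar - v)‖ ≤ ε / ρ * (2 * D) := by
      rw [norm_smul, Real.norm_of_nonneg (by positivity)]
      have h2 : ‖xbar - v‖ ≤ 2 * D := (norm_sub_le _ _).trans (by linarith)
      gcongr
      linarith
    calc ∑ i, ‖y i - (v + (ε / (ε + ρ)) • (xbar - v))‖
        ≤ ∑ i : Fin m, (‖y i - v‖ + ε / ρ * (2 * D)) := by
          refine Finset.sum_le_sum fun i _ => ?_
          rw [← sub_sub]
          exact (norm_sub_le _ _).trans (add_le_add le_rfl hd)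
      _ = _ := by
          rw [Finset.sum_add_distrib, ← hε]
          simp only [Finset.sum_const, Finset.card_univ, Fintype.card_fin, nsmul_eq_mul]
          field_simp
          ring

/-- Summing geometric averages of `u` against a nonincreasing weight. -/
theorem sum_mul_geometric_average_le {c u : ℕ → ℝ} (hc : Antitone c) (hc₀ : ∀ k, 0 ≤ c k)
    (hu : ∀ k, 0 ≤ u k) {q : ℝ} (hq₀ : 0 ≤ q) (hq₁ : q < 1) (N : ℕ) :
    ∑ k ∈ Finset.Icc 1 N, c k * ∑ r ∈ Finset.range k, q ^ (k - 1 - r) * u r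
      ≤ 1 / (1 - q) * ∑ r ∈ Finset.range N, c r * u r := by
  have hq : 0 < 1 - q := by linarith
  have hW : ∀ N, 0 ≤ ∑ r ∈ Finset.range N, q ^ (N - 1 - r) * u r := fun N =>
    Finset.sum_nonneg fun r _ => mul_nonneg (by positivity) (hu r)
  have hstrong : ∑ k ∈ Finset.Icc 1 N, c k * ∑ r ∈ Finset.range k, q ^ (k - 1 - r) * u r
      + q / (1 - q) * (c N * ∑ r ∈ Finset.range N, q ^ (N - 1 - r) * u r)
      ≤ 1 / (1 - q) * ∑ r ∈ Finset.range N, c r * u r := by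
    induction N with
    | zero => simp
    | succ N ih =>
      have hrec : ∑ r ∈ Finset.range (N + 1), q ^ (N + 1 - 1 - r) * u r
          = q * ∑ r ∈ Finset.range N, q ^ (N - 1 - r) * u r + u N := by
        rw [Finset.sum_range_succ, Finset.mul_sum]
        simp only [Nat.add_sub_cancel, Nat.sub_self, pow_zero, one_mul]
        congr 1
        refine Finset.sum_congr rfl fun r hr => ?_
        have hr := Finset.mem_range.1 hr
        have h3 : N - r = (N - 1 - r) + 1 := by omega
        rw [h3, pow_succ']
        ring
      rw [Finset.sum_Icc_succ_top (by omega), hrec, Finset.sum_range_succ _ N]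
      have hle := hc (Nat.le_succ N)
      set W := ∑ r ∈ Finset.range N, q ^ (N - 1 - r) * u r with hWdef
      have hW' : 0 ≤ q * W + u N := by have := hW N; have := hu N; positivity
      have h1 : c (N + 1) * (q * W + u N) + q / (1 - q) * (c (N + 1) * (q * W + u N))
          = 1 / (1 - q) * (c (N + 1) * (q * W + u N)) := by
        field_simp
        ring
      have h2 : 1 / (1 - q) * (c (N + 1) * (q * W + u N))
          ≤ 1 / (1 - q) * (c N * (q * W + u N)) := by gcongr
      have h3 : 1 / (1 - q) * (c N * (q * W + u N))
          = q / (1 - q) * (c N * W) + 1 / (1 - q) * (c N * u N) := by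
        field_simp
      linarith
  have := mul_nonneg (div_nonneg hq₀ hq.le) (mul_nonneg (hc₀ N) (hW N))
  linarith

theorem sum_Icc_mul_pow_le {c : ℕ → ℝ} (hc : Antitone c) (hc₀ : ∀ k, 0 ≤ c k) {q : ℝ}
    (hq₀ : 0 ≤ q) (hq₁ : q < 1) (N : ℕ) :
    ∑ k ∈ Finset.Icc 1 N, c k * q ^ k ≤ c 1 * (q / (1 - q)) := by
  have hq : 0 < 1 - q := by linarith
  have hgeom : ∑ k ∈ Finset.Icc 1 N, q ^ k = q / (1 - q) * (1 - q ^ N) := by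
    induction N with
    | zero => simp
    | succ N ih =>
      rw [Finset.sum_Icc_succ_top (by omega), ih]
      field_simp
      ring
  calc ∑ k ∈ Finset.Icc 1 N, c k * q ^ k ≤ ∑ k ∈ Finset.Icc 1 N, c 1 * q ^ k := by
        refine Finset.sum_le_sum fun k hk => ?_
        exact mul_le_mul_of_nonneg_right (hc (Finset.mem_Icc.1 hk).1) (by positivity)
    _ = c 1 * (q / (1 - q) * (1 - q ^ N)) := by rw [← Finset.mul_sum, hgeom]
    _ ≤ c 1 * (q / (1 - q)) := by
        refine mul_le_mul_of_nonneg_left ?_ (hc₀ 1)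
        refine mul_le_of_le_one_right (div_nonneg hq₀ hq.le) ?_
        linarith [pow_nonneg hq₀ N]

theorem young_sum {m : ℕ} {α : ℝ} (hα : 0 < α) (b : ℝ) (g : Fin m → ℝ) :
    2 * (b * ∑ j, g j) ≤ 2 / α * m * b ^ 2 + α / 2 * ∑ j, g j ^ 2 := by
  have h : ∀ j, 2 * (b * g j) ≤ 2 / α * b ^ 2 + α / 2 * g j ^ 2 := by
    intro j
    have : 2 / α * b ^ 2 + α / 2 * g j ^ 2 - 2 * (b * g j)
        = 1 / (2 * α) * (2 * b - α * g j) ^ 2 := by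
      field_simp
      ring
    have : 0 ≤ 1 / (2 * α) * (2 * b - α * g j) ^ 2 := by positivity
    linarith
  have := Finset.sum_le_sum fun j (_ : j ∈ Finset.univ) => h j
  simp only [Finset.sum_add_distrib, ← Finset.mul_sum, Finset.sum_const, Finset.card_univ,
    Fintype.card_fin, nsmul_eq_mul] at this
  linarith

theorem stmt11
    (n m : ℕ) (hm : 2 ≤ m)
    (X : Fin m → Set (EuclideanSpace ℝ (Fin n)))
    (hXne : ∀ i, (X i).Nonempty)
    (hXcpt : ∀ i, IsCompact (X i))
    (hXconv : ∀ i, Convex ℝ (X i))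
    (f : Fin m → EuclideanSpace ℝ (Fin n) → ℝ)
    (hfconv : ∀ i, ConvexOn ℝ Set.univ (f i))
    (Lbar : ℝ) (hLbar : 0 < Lbar)
    (hLip : ∀ i, ∀ p₁ ∈ X i, ∀ p₂ ∈ X i, |f i p₁ - f i p₂| ≤ Lbar * ‖p₁ - p₂‖)
    (D : ℝ) (hD : 0 < D)
    (hDbound : ∀ p ∈ convexHull ℝ (⋃ i, X i), ‖p‖ ≤ D)
    (xbar : EuclideanSpace ℝ (Fin n)) (ρ : ℝ) (hρ : 0 < ρ)
    (hball : Metric.ball xbar ρ ⊆ ⋂ i, X i)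
    (Xstar : Set (EuclideanSpace ℝ (Fin n)))
    (hXstar : Xstar = {p | p ∈ ⋂ i, X i ∧ ∀ y ∈ ⋂ i, X i, ∑ i, f i p ≤ ∑ i, f i y})
    (hXstar_ne : Xstar.Nonempty)
    (a : ℕ → Fin m → Fin m → ℝ)
    (ha_nonneg : ∀ k i j, 0 ≤ a k i j)
    (ha_row : ∀ k i, ∑ j, a k i j = 1)
    (ha_col : ∀ k j, ∑ i, a k i j = 1)
    (η : ℝ) (hη : η ∈ Set.Ioo (0:ℝ) 1)
    (ha_diag : ∀ k i, η ≤ a k i i)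
    (ha_eta : ∀ k i j, 0 < a k i j → η ≤ a k i j)
    (hconn : ∀ u v : Fin m,
      Relation.ReflTransGen (fun p1 p2 => {k : ℕ | 0 < a k p2 p1}.Infinite) u v)
    (T : ℕ) (hT : 1 ≤ T)
    (hTcomm : ∀ j i : Fin m, {k : ℕ | 0 < a k i j}.Infinite →
      ∀ k : ℕ, ∃ l, k ≤ l ∧ l < k + T ∧ 0 < a l i j)
    (c : ℕ → ℝ) (hc_pos : ∀ k, 0 < c k) (hc_anti : Antitone c)
    (hc_div : Tendsto (fun N => ∑ k ∈ Finset.range N, c k) atTop atTop)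
    (hc_sq : Summable (fun k => (c k)^2))
    (x : Fin m → ℕ → EuclideanSpace ℝ (Fin n))
    (hx0 : ∀ i, x i 0 ∈ X i)
    (z : Fin m → ℕ → EuclideanSpace ℝ (Fin n))
    (hz : ∀ i k, z i k = ∑ j, a k i j • x j k)
    (hupd_mem : ∀ i k, x i (k+1) ∈ X i)
    (hupd_min : ∀ i k, ∀ y ∈ X i,
      f i (x i (k+1)) + (1/(2 * c k)) * ‖z i k - x i (k+1)‖^2
        ≤ f i y + (1/(2 * c k)) * ‖z i k - y‖^2)
    (hupd_uniq : ∀ i k, ∀ y ∈ X i,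
      f i y + (1/(2 * c k)) * ‖z i k - y‖^2
        = f i (x i (k+1)) + (1/(2 * c k)) * ‖z i k - x i (k+1)‖^2 → y = x i (k+1))
    (μ : ℝ) (hμ : μ = (2 / ρ) * (m : ℝ) * D + 1)
    (lam q : ℝ)
    (hlam : lam = 2 * (1 + (η ^ ((m - 1) * T))⁻¹) / (1 - η ^ ((m - 1) * T)))
    (hq : q = Real.rpow (1 - η ^ ((m - 1) * T)) ((((m - 1) * T : ℕ) : ℝ))⁻¹)
    (α₁ : ℝ) (hα₁ : α₁ ∈ Set.Ioo (0:ℝ) 1)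
    (α₂ α₃ : ℝ)
    (hα₂ : α₂ = (2 / α₁) * (m : ℝ) * μ^2 * Lbar^2
      * ((m : ℝ)^2 * lam^2 * (1 / (1 - q)^2) + 4))
    (hα₃ : α₃ = 2 * (m : ℝ)^3 * μ^2 * lam^2 * Lbar^2 * (c 0)^2 * (1 / (α₁ * (1 - q)^2))
      + 2 * (m : ℝ)^2 * μ * lam * Lbar * D * c 1 * (q / (1 - q)) + 2 * α₁ * (m : ℝ) * D^2)
    :
    ∀ N : ℕ, 1 ≤ N → ∀ xstar ∈ Xstar,
      (1 - α₁) * ∑ k ∈ Finset.Icc 1 N, ∑ i, ‖x i (k + 1) - z i k‖^2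
        ≤ (∑ i, ‖x i 1 - xstar‖^2) + α₂ * ∑ k ∈ Finset.Icc 1 N, (c k)^2 + α₃ := by
  intro N hN xstar hxstar
  obtain ⟨hη₀, hη₁⟩ := hη
  obtain ⟨hα₀, hα₁'⟩ := hα₁
  rw [hXstar] at hxstar
  obtain ⟨hxs, hopt⟩ := hxstar
  have hm0 : 0 < m := by omega
  have hmR : (0 : ℝ) < m := by exact_mod_cast hm0
  set B := (m - 1) * T with hB
  have hBpos : 0 < B := Nat.mul_pos (by omega) hT
  set θ := η ^ B with hθ
  have hθ₀ : 0 < θ := by positivity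
  have hθ₁ : θ < 1 := pow_lt_one₀ hη₀.le hη₁ hBpos.ne'
  have h1θ : 0 < 1 - θ := by linarith
  have hBR : (0 : ℝ) < ((B : ℕ) : ℝ)⁻¹ := by positivity
  have hq₀ : 0 < q := by rw [hq]; exact Real.rpow_pos_of_pos h1θ _
  have hq₁ : q < 1 := by rw [hq]; exact Real.rpow_lt_one h1θ.le (by linarith) hBR
  have hqB : q ^ B = 1 - θ := by
    rw [hq]; exact Real.rpow_inv_natCast_pow h1θ.le hBpos.ne'
  have h1q : 0 < 1 - q := by linarith
  have hlam₀ : 0 < lam := by rw [hlam]; positivity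
  have hlam₁ : 1 / (1 - θ) ≤ lam := by
    rw [hlam]
    gcongr
    have : 0 < θ⁻¹ := by positivity
    linarith
  have hmemD : ∀ i, ∀ p ∈ X i, ‖p‖ ≤ D := fun i p hp =>
    hDbound p (subset_convexHull ℝ _ (Set.mem_iUnion.2 ⟨i, hp⟩))
  have hxmem : ∀ i k, x i k ∈ X i := by
    intro i k
    cases k with
    | zero => exact hx0 i
    | succ k => exact hupd_mem i k
  have hμ₀ : 0 < μ := by rw [hμ]; positivity
  have hxbar : ‖xbar‖ ≤ D :=
    hmemD ⟨0, hm0⟩ _ (Set.mem_iInter.1 (hball (Metric.mem_ball_self hρ)) _)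
  have havg : ∀ w : Fin m → ℝ, (∀ j, 0 ≤ w j) → ∑ j, w j = 1 → ∀ k,
      ‖∑ j, w j • x j k‖ ≤ D := by
    intro w hw hsum k
    calc ‖∑ j, w j • x j k‖ ≤ ∑ j, w j * D := by
          refine (norm_sum_le _ _).trans (Finset.sum_le_sum fun j _ => ?_)
          rw [norm_smul, Real.norm_of_nonneg (hw j)]
          exact mul_le_mul_of_nonneg_left (hmemD j _ (hxmem j k)) (hw j)
      _ = D := by rw [← Finset.sum_mul, hsum, one_mul]
  let e : Fin m → ℕ → EuclideanSpace ℝ (Fin n) := fun i k => x i (k + 1) - z i k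
  have hrec : ∀ i k, x i (k + 1) = (∑ j, a k i j • x j k) + e i k := by
    intro i k
    simp only [e, hz]
    abel
  let v : ℕ → EuclideanSpace ℝ (Fin n) := fun k => (1 / m : ℝ) • ∑ j, x j k
  have hv : ∀ k, ‖v k‖ ≤ D := by
    intro k
    simp only [v, Finset.smul_sum]
    exact havg (fun _ => 1 / m) (fun _ => by positivity) (by simp [hmR.ne']) k
  let S : ℕ → ℝ := fun k => ∑ i, ‖x i (k + 1) - v (k + 1)‖
  let G : ℕ → ℝ := fun k => ∑ i, ‖e i k‖
  let Q : ℕ → ℝ := fun k => ∑ i, ‖e i k‖ ^ 2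
  let V : ℕ → ℝ := fun k => ∑ i, ‖x i k - xstar‖ ^ 2
  let W : ℕ → ℝ := fun k => ∑ r ∈ Finset.range k, q ^ (k - 1 - r) * G r
  have hbound : ∀ s t i j, |transition a s (t + 1) i j - 1 / m| ≤ lam * q ^ t := by
    intro s t i j
    refine (abs_transition_sub_le ha_nonneg ha_row ha_col hBpos hθ₁ hq₀ hq₁.le hqB
      (pow_le_transition ha_nonneg hη₀.le ha_diag ha_eta hconn hTcomm) s (t + 1) i j).trans ?_
    calc q ^ (t + 1) / (1 - θ) = 1 / (1 - θ) * (q ^ t * q) := by ring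
      _ ≤ lam * (q ^ t * 1) := by gcongr
      _ = lam * q ^ t := by ring
  have hS : ∀ k, S k ≤ m * (lam * q ^ k * (m * D)) + 2 * G k + m * (lam * W k) := by
    intro k
    refine (sum_norm_sub_mean_le ha_col hm0 hbound hrec k).trans ?_
    have : ∑ j, ‖x j 0‖ ≤ m * D := by
      simpa using Finset.sum_le_sum fun j (_ : j ∈ Finset.univ) => hmemD j _ (hx0 j)
    have : m * (lam * q ^ k * ∑ j, ‖x j 0‖) ≤ m * (lam * q ^ k * (m * D)) := by gcongr
    linarith
  have hstep : ∀ k, V (k + 1) + Q k ≤ V k + 2 * c k * (Lbar * (μ * S k)) := by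
    intro k
    obtain ⟨p, hp, hpS⟩ := exists_common_point (fun i => (hXcpt i).isClosed) hXconv hρ hball
      hxbar (fun i => hupd_mem i k) (hv (k + 1))
    rw [← hμ] at hpS
    have hz' : ∑ i, ‖z i k - xstar‖ ^ 2 ≤ V k := by
      calc ∑ i, ‖z i k - xstar‖ ^ 2 ≤ ∑ i, ∑ j, a k i j * ‖x j k - xstar‖ ^ 2 := by
            refine Finset.sum_le_sum fun i _ => ?_
            rw [hz]
            exact norm_sum_smul_sub_sq_le (ha_nonneg k i) (ha_row k i) _ _
        _ = V k := by
            rw [Finset.sum_comm]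
            simp only [← Finset.sum_mul, ha_col, one_mul, V]
    have hprox := Finset.sum_le_sum fun i (_ : i ∈ Finset.univ) =>
      prox_inequality (hXconv i) (hfconv i) (hc_pos k) (hupd_mem i k) (hupd_min i k)
        (Set.mem_iInter.1 hxs i)
    rw [Finset.sum_add_distrib, Finset.sum_add_distrib, ← Finset.mul_sum,
      Finset.sum_sub_distrib] at hprox
    have hf : ∑ i, f i xstar - ∑ i, f i (x i (k + 1)) ≤ Lbar * (μ * S k) := by
      calc ∑ i, f i xstar - ∑ i, f i (x i (k + 1))
          ≤ ∑ i, f i p - ∑ i, f i (x i (k + 1)) := sub_le_sub_right (hopt p hp) _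
        _ ≤ ∑ i, Lbar * ‖x i (k + 1) - p‖ := by
            rw [← Finset.sum_sub_distrib]
            refine Finset.sum_le_sum fun i _ => ?_
            rw [norm_sub_rev]
            exact (le_abs_self _).trans
              (hLip i _ (Set.mem_iInter.1 hp i) _ (hupd_mem i k))
        _ ≤ Lbar * (μ * S k) := by
            rw [← Finset.mul_sum]
            exact mul_le_mul_of_nonneg_left hpS hLbar.le
    have := mul_le_mul_of_nonneg_left hf (mul_pos two_pos (hc_pos k)).le
    simp only [V, Q, e] at hz' ⊢
    linarith
  have htele : V (N + 1) + ∑ k ∈ Finset.Icc 1 N, Q k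
      ≤ V 1 + ∑ k ∈ Finset.Icc 1 N, 2 * c k * (Lbar * (μ * S k)) := by
    clear hN
    induction N with
    | zero => simp
    | succ N ih =>
      rw [Finset.sum_Icc_succ_top (by omega), Finset.sum_Icc_succ_top (by omega)]
      linarith [hstep (N + 1)]
  have hV : 0 ≤ V (N + 1) := Finset.sum_nonneg fun _ _ => by positivity
  have hG : ∀ k, 0 ≤ G k := fun k => Finset.sum_nonneg fun _ _ => norm_nonneg _
  have hQ : ∀ k, 0 ≤ Q k := fun k => Finset.sum_nonneg fun _ _ => by positivity
  have hQ0 : Q 0 ≤ m * (2 * D) ^ 2 := by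
    have : ∀ i, ‖e i 0‖ ^ 2 ≤ (2 * D) ^ 2 := by
      intro i
      have h1 : ‖e i 0‖ ≤ 2 * D := by
        refine (norm_sub_le _ _).trans ?_
        rw [hz, two_mul]
        exact add_le_add (hmemD i _ (hxmem i _)) (havg _ (ha_nonneg 0 i) (ha_row 0 i) 0)
      gcongr
    simpa [Q] using Finset.sum_le_sum fun i (_ : i ∈ Finset.univ) => this i
  have hc₀ : ∀ k, 0 ≤ c k := fun k => (hc_pos k).le
  have hsplit : ∑ k ∈ Finset.Icc 1 N, 2 * c k * (Lbar * (μ * S k))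
      ≤ 2 * (m : ℝ) ^ 2 * μ * lam * Lbar * D * ∑ k ∈ Finset.Icc 1 N, c k * q ^ k
        + ∑ k ∈ Finset.Icc 1 N, 2 * ((2 * μ * Lbar * c k) * G k)
        + 2 * m * μ * lam * Lbar * ∑ k ∈ Finset.Icc 1 N, c k * W k := by
    rw [Finset.mul_sum, Finset.mul_sum, ← Finset.sum_add_distrib, ← Finset.sum_add_distrib]
    refine Finset.sum_le_sum fun k _ => ?_
    have hck := hc_pos k
    calc 2 * c k * (Lbar * (μ * S k)) ≤ 2 * c k * (Lbar * (μ *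
          (m * (lam * q ^ k * (m * D)) + 2 * G k + m * (lam * W k)))) := by
          gcongr
          exact hS k
      _ = _ := by ring
  have hterm₁ := sum_Icc_mul_pow_le hc_anti hc₀ hq₀.le hq₁ N
  have hterm₂ : ∑ k ∈ Finset.Icc 1 N, 2 * ((2 * μ * Lbar * c k) * G k)
      ≤ 2 / α₁ * m * (2 * μ * Lbar) ^ 2 * ∑ k ∈ Finset.Icc 1 N, c k ^ 2
        + α₁ / 2 * ∑ k ∈ Finset.Icc 1 N, Q k := by
    rw [Finset.mul_sum, Finset.mul_sum, ← Finset.sum_add_distrib]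
    refine Finset.sum_le_sum fun k _ => (young_sum hα₀ _ _).trans (le_of_eq ?_)
    simp only [Q]
    ring
  have hrange : ∀ u : ℕ → ℝ, (∀ k, 0 ≤ u k) →
      ∑ k ∈ Finset.range N, u k ≤ u 0 + ∑ k ∈ Finset.Icc 1 N, u k := by
    intro u hu
    have h1 : Finset.range (N + 1) = insert 0 (Finset.Icc 1 N) := by
      ext k
      simp only [Finset.mem_range, Finset.mem_insert, Finset.mem_Icc]
      omega
    rw [← Finset.sum_insert (by simp), ← h1, Finset.sum_range_succ]
    linarith [hu N]
  set b := m * μ * lam * Lbar * (1 / (1 - q)) with hb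
  have hterm₃ : 2 * m * μ * lam * Lbar * ∑ k ∈ Finset.Icc 1 N, c k * W k
      ≤ 2 / α₁ * m * b ^ 2 * (c 0 ^ 2 + ∑ k ∈ Finset.Icc 1 N, c k ^ 2)
        + α₁ / 2 * (Q 0 + ∑ k ∈ Finset.Icc 1 N, Q k) := by
    calc 2 * m * μ * lam * Lbar * ∑ k ∈ Finset.Icc 1 N, c k * W k
        ≤ 2 * m * μ * lam * Lbar * (1 / (1 - q) * ∑ r ∈ Finset.range N, c r * G r) :=
          mul_le_mul_of_nonneg_left
            (sum_mul_geometric_average_le hc_anti hc₀ hG hq₀.le hq₁ N) (by positivity)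
      _ = ∑ r ∈ Finset.range N, 2 * ((b * c r) * G r) := by
          simp only [Finset.mul_sum, hb]
          refine Finset.sum_congr rfl fun r _ => ?_
          ring
      _ ≤ ∑ r ∈ Finset.range N, (2 / α₁ * m * b ^ 2 * c r ^ 2 + α₁ / 2 * Q r) := by
          refine Finset.sum_le_sum fun k _ => (young_sum hα₀ _ _).trans (le_of_eq ?_)
          simp only [Q]
          ring
      _ = 2 / α₁ * m * b ^ 2 * ∑ r ∈ Finset.range N, c r ^ 2
          + α₁ / 2 * ∑ r ∈ Finset.range N, Q r := by
          rw [Finset.sum_add_distrib, Finset.mul_sum, Finset.mul_sum]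
      _ ≤ _ := by
          gcongr
          · exact hrange _ fun k => by positivity
          · exact hrange _ hQ
  have hterm₁' := mul_le_mul_of_nonneg_left hterm₁
    (show 0 ≤ 2 * (m : ℝ) ^ 2 * μ * lam * Lbar * D by positivity)
  have hQ0' := mul_le_mul_of_nonneg_left hQ0 (half_pos hα₀).le
  have hcoef : α₂ = 2 / α₁ * m * (2 * μ * Lbar) ^ 2 + 2 / α₁ * m * b ^ 2 := by
    rw [hα₂, hb]
    field_simp
    ring
  have hconst : α₃ = 2 / α₁ * m * b ^ 2 * c 0 ^ 2
      + 2 * (m : ℝ) ^ 2 * μ * lam * Lbar * D * (c 1 * (q / (1 - q)))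
      + α₁ / 2 * (m * (2 * D) ^ 2) := by
    rw [hα₃, hb]
    field_simp
  change (1 - α₁) * ∑ k ∈ Finset.Icc 1 N, Q k
    ≤ V 1 + α₂ * ∑ k ∈ Finset.Icc 1 N, (c k) ^ 2 + α₃
  rw [hcoef, hconst]
  linarith
end

section
/- For every k ≥ 0 and every x* ∈ ⋂_{i=1}^m X_i (in particular every minimizer of ∑_i f_i over ⋂_i X_i): 2c(k)∑_{i=1}^m f_i(x_i(k+1)) + ∑_{i=1}^m ‖x_i(k+1) − z_i(k)‖² + ∑_{i=1}^m ‖x_i(k+1) − x*‖² ≤ 2c(k)∑_{i=1}^m f_i(x*) + ∑_{i=1}^m ‖x_i(k) − x*‖². -/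
open Filter Finset Metric
open scoped Topology BigOperators

section ProximalStep

variable {E : Type*} [NormedAddCommGroup E] [InnerProductSpace ℝ E]

/-- The squared distance to a point is quadratic along segments. -/
lemma norm_sub_convexComb_sq (z p y : E) (t : ℝ) :
    ‖z - ((1 - t) • p + t • y)‖ ^ 2
      = (1 - t) * ‖z - p‖ ^ 2 + t * ‖z - y‖ ^ 2 - t * (1 - t) * ‖p - y‖ ^ 2 := by
  have h₁ : z - ((1 - t) • p + t • y) = (1 - t) • (z - p) + t • (z - y) := by module
  have h₂ : p - y = (z - y) - (z - p) := by abel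
  rw [h₁, h₂, norm_add_sq_real, norm_sub_sq_real (z - y), norm_smul, norm_smul, mul_pow, mul_pow,
    real_inner_smul_left, real_inner_smul_right, real_inner_comm (z - p) (z - y),
    Real.norm_eq_abs, Real.norm_eq_abs, sq_abs, sq_abs]
  ring

/-- The three-point inequality for a proximal step `p` from `z` with parameter `s`. -/
lemma ConvexOn.add_mul_norm_sq_le_of_prox {S : Set E} {g : E → ℝ} (hg : ConvexOn ℝ S g)
    {s : ℝ} (hs : 0 ≤ s) {z p y : E} (hp : p ∈ S) (hy : y ∈ S)
    (hmin : ∀ w ∈ S, g p + s * ‖z - p‖ ^ 2 ≤ g w + s * ‖z - w‖ ^ 2) :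
    g p + s * ‖z - p‖ ^ 2 + s * ‖p - y‖ ^ 2 ≤ g y + s * ‖z - y‖ ^ 2 := by
  have key : ∀ t : ℝ, 0 < t → t < 1 →
      g p + s * ‖z - p‖ ^ 2 + (1 - t) * (s * ‖p - y‖ ^ 2) ≤ g y + s * ‖z - y‖ ^ 2 := by
    intro t ht ht1
    have h₁ := hmin _ (hg.1 hp hy (sub_nonneg.2 ht1.le) ht.le (sub_add_cancel 1 t))
    have h₂ := hg.2 hp hy (sub_nonneg.2 ht1.le) ht.le (sub_add_cancel 1 t)
    rw [norm_sub_convexComb_sq] at h₁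
    simp only [smul_eq_mul] at h₂
    refine le_of_mul_le_mul_left ?_ ht
    linarith
  have hB : 0 ≤ s * ‖p - y‖ ^ 2 := by positivity
  generalize s * ‖p - y‖ ^ 2 = B at *
  by_contra! hlt
  set d := g p + s * ‖z - p‖ ^ 2 + B - (g y + s * ‖z - y‖ ^ 2) with hd
  have hdpos : 0 < d := by linarith
  have ht := key (d / (2 * (B + d))) (by positivity) (by rw [div_lt_one (by positivity)]; linarith)
  have htB : d / (2 * (B + d)) * B < d := by
    rw [div_mul_eq_mul_div, div_lt_iff₀ (by positivity)]
    nlinarith [mul_nonneg hdpos.le hB, mul_pos hdpos hdpos]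
  linarith

/-- Averaging with doubly stochastic weights does not increase the sum of squared distances
to a point. -/
lemma sum_norm_weighted_sub_sq_le {ι : Type*} [Fintype ι] {w : ι → ι → ℝ}
    (hw : ∀ i j, 0 ≤ w i j) (hrow : ∀ i, ∑ j, w i j = 1) (hcol : ∀ j, ∑ i, w i j = 1)
    (v : ι → E) (y : E) :
    ∑ i, ‖∑ j, w i j • v j - y‖ ^ 2 ≤ ∑ i, ‖v i - y‖ ^ 2 := by
  have hconv : ConvexOn ℝ Set.univ fun u : E ↦ ‖u‖ ^ 2 :=
    convexOn_univ_norm.pow (fun _ _ ↦ norm_nonneg _) 2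
  calc ∑ i, ‖∑ j, w i j • v j - y‖ ^ 2
      ≤ ∑ i, ∑ j, w i j * ‖v j - y‖ ^ 2 := by
        refine Finset.sum_le_sum fun i _ ↦ ?_
        have h := hconv.map_sum_le (t := Finset.univ) (w := w i) (p := fun j ↦ v j - y)
          (fun j _ ↦ hw i j) (hrow i) (fun _ _ ↦ Set.mem_univ _)
        simpa only [smul_sub, Finset.sum_sub_distrib, ← Finset.sum_smul, hrow i, one_smul,
          smul_eq_mul] using h
    _ = ∑ j, ‖v j - y‖ ^ 2 := by
        rw [Finset.sum_comm]
        simp_rw [← Finset.sum_mul, hcol, one_mul]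

end ProximalStep

theorem stmt12
    (n m : ℕ) (hm : 1 ≤ m)
    (X : Fin m → Set (EuclideanSpace ℝ (Fin n)))
    (hXne : ∀ i, (X i).Nonempty)
    (hXcpt : ∀ i, IsCompact (X i))
    (hXconv : ∀ i, Convex ℝ (X i))
    (f : Fin m → EuclideanSpace ℝ (Fin n) → ℝ)
    (hfconv : ∀ i, ConvexOn ℝ Set.univ (f i))
    (hint : (⋂ i, X i).Nonempty)
    (a : ℕ → Fin m → Fin m → ℝ)
    (ha_nonneg : ∀ k i j, 0 ≤ a k i j)
    (ha_row : ∀ k i, ∑ j, a k i j = 1)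
    (ha_col : ∀ k j, ∑ i, a k i j = 1)
    (c : ℕ → ℝ) (hc_pos : ∀ k, 0 < c k)
    (x : Fin m → ℕ → EuclideanSpace ℝ (Fin n))
    (hx0 : ∀ i, x i 0 ∈ X i)
    (z : Fin m → ℕ → EuclideanSpace ℝ (Fin n))
    (hz : ∀ i k, z i k = ∑ j, a k i j • x j k)
    (hupd_mem : ∀ i k, x i (k+1) ∈ X i)
    (hupd_min : ∀ i k, ∀ y ∈ X i,
      f i (x i (k+1)) + (1/(2 * c k)) * ‖z i k - x i (k+1)‖^2
        ≤ f i y + (1/(2 * c k)) * ‖z i k - y‖^2)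
    (hupd_uniq : ∀ i k, ∀ y ∈ X i,
      f i y + (1/(2 * c k)) * ‖z i k - y‖^2
        = f i (x i (k+1)) + (1/(2 * c k)) * ‖z i k - x i (k+1)‖^2 → y = x i (k+1))
    :
    ∀ k : ℕ, ∀ xstar ∈ ⋂ i, X i,
      2 * c k * (∑ i, f i (x i (k + 1))) + (∑ i, ‖x i (k + 1) - z i k‖^2)
          + (∑ i, ‖x i (k + 1) - xstar‖^2)
        ≤ 2 * c k * (∑ i, f i xstar) + (∑ i, ‖x i k - xstar‖^2) := by
  intro k xstar hxstar
  have hmem := Set.mem_iInter.1 hxstar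
  have hstep : ∀ i, 2 * c k * f i (x i (k + 1)) + ‖x i (k + 1) - z i k‖ ^ 2
      + ‖x i (k + 1) - xstar‖ ^ 2 ≤ 2 * c k * f i xstar + ‖z i k - xstar‖ ^ 2 := by
    intro i
    have hc := hc_pos k
    have h := ((hfconv i).subset (Set.subset_univ _) (hXconv i)).add_mul_norm_sq_le_of_prox
      (by positivity) (hupd_mem i k) (hmem i) (hupd_min i k)
    have h' := mul_le_mul_of_nonneg_left h (by positivity : 0 ≤ 2 * c k)
    have hcancel : 2 * c k * (1 / (2 * c k)) = 1 := mul_one_div_cancel (by positivity)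
    simp only [mul_add, ← mul_assoc, hcancel, one_mul] at h'
    rwa [norm_sub_rev (x i (k + 1)) (z i k)]
  have hsum := Finset.sum_le_sum fun i (_ : i ∈ Finset.univ) ↦ hstep i
  simp only [Finset.sum_add_distrib, ← Finset.mul_sum] at hsum
  have havg := sum_norm_weighted_sub_sq_le (ha_nonneg k) (ha_row k) (ha_col k)
    (fun j ↦ x j k) xstar
  simp only [← hz] at havg
  linarith
end

section
/- Let (Ω, 𝒢, Q) and (Δ, 𝒟, P) be probability spaces, m ≥ 1, and for each i = 1,…,m let A_i ⊆ Ω × Δ be measurable with respect to the product σ-algebra. Let d ∈ ℕ, let β_i ∈ [0,1], let ε_i : {0,1,…,d} → [0,1], and let d_i : Ω → {0,1,…,d} be measurable functions with ∑_{i=1}^m d_i(ω) ≤ d for every ω ∈ Ω. Suppose that for each i, Q{ω ∈ Ω : P{δ ∈ Δ : (ω,δ) ∈ A_i} ≤ ε_i(d_i(ω))} ≥ 1 − β_i. Define ε as the maximum of ∑_{i=1}^m ε_i(d_i') over all tuples (d_1',…,d_m') of nonnegative integers with ∑_{i=1}^m d_i' ≤ d. Then Q{ω ∈ Ω : P{δ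 ∈ Δ : (ω,δ) ∈ ⋃_{i=1}^m A_i} ≤ ε} ≥ 1 − ∑_{i=1}^m β_i. -/
open MeasureTheory

/-- A Bonferroni-type bound: the intersection of finitely many events of probability at least
`1 - β i` has probability at least `1 - ∑ i, β i`. -/
theorem one_sub_sum_le_measureReal_iInter {Ω ι : Type*} [Fintype ι] [MeasurableSpace Ω]
    (Q : Measure Ω) [IsProbabilityMeasure Q] {F : ι → Set Ω} (hF : ∀ i, MeasurableSet (F i))
    {β : ι → ℝ} (h : ∀ i, 1 - β i ≤ Q.real (F i)) :
    1 - ∑ i, β i ≤ Q.real (⋂ i, F i) := by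
  have hcompl : Q.real (⋂ i, F i)ᶜ ≤ ∑ i, β i := by
    rw [Set.compl_iInter]
    refine (measureReal_iUnion_fintype_le _).trans (Finset.sum_le_sum fun i _ => ?_)
    rw [probReal_compl_eq_one_sub (hF i)]
    linarith [h i]
  rw [probReal_compl_eq_one_sub (MeasurableSet.iInter hF)] at hcompl
  linarith

theorem stmt17
    {Ω Δ : Type*} [MeasurableSpace Ω] [MeasurableSpace Δ]
    (Q : Measure Ω) [IsProbabilityMeasure Q]
    (P : Measure Δ) [IsProbabilityMeasure P]
    (m : ℕ) (hm : 1 ≤ m)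
    (A : Fin m → Set (Ω × Δ)) (hA : ∀ i, MeasurableSet (A i))
    (d : ℕ) (β : Fin m → ℝ) (hβ : ∀ i, β i ∈ Set.Icc (0:ℝ) 1)
    (εf : Fin m → ℕ → ℝ) (hεf : ∀ i k, k ≤ d → εf i k ∈ Set.Icc (0:ℝ) 1)
    (dN : Fin m → Ω → ℕ) (hdN_meas : ∀ i, Measurable (dN i))
    (hdN_le : ∀ i ω, dN i ω ≤ d)
    (hdN_sum : ∀ ω, ∑ i, dN i ω ≤ d)
    (hfeas : ∀ i, ENNReal.ofReal (1 - β i)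
      ≤ Q {ω | (P {δ | (ω, δ) ∈ A i}).toReal ≤ εf i (dN i ω)})
    (ε : ℝ)
    (hε : IsGreatest {s : ℝ | ∃ d' : Fin m → ℕ,
      (∑ i, d' i) ≤ d ∧ s = ∑ i, εf i (d' i)} ε) :
    ENNReal.ofReal (1 - ∑ i, β i)
      ≤ Q {ω | (P {δ | (ω, δ) ∈ ⋃ i, A i}).toReal ≤ ε} := by
  have hF : ∀ i, MeasurableSet {ω | (P {δ | (ω, δ) ∈ A i}).toReal ≤ εf i (dN i ω)} := fun i =>
    measurableSet_le (measurable_measure_prodMk_left (hA i)).ennreal_toReal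
      (measurable_from_nat.comp (hdN_meas i))
  have hreal := one_sub_sum_le_measureReal_iInter Q hF fun i =>
    (ENNReal.ofReal_le_iff_le_toReal (measure_ne_top _ _)).1 (hfeas i)
  refine ((ENNReal.ofReal_le_iff_le_toReal (measure_ne_top _ _)).2 hreal).trans
    (measure_mono fun ω hω => ?_)
  have hunion : {δ | (ω, δ) ∈ ⋃ i, A i} = ⋃ i, {δ | (ω, δ) ∈ A i} := by
    ext δ
    simp
  calc (P {δ | (ω, δ) ∈ ⋃ i, A i}).toReal
      ≤ ∑ i, (P {δ | (ω, δ) ∈ A i}).toReal := by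
        rw [hunion]
        exact measureReal_iUnion_fintype_le _
    _ ≤ ∑ i, εf i (dN i ω) := Finset.sum_le_sum fun i _ => Set.mem_iInter.1 hω i
    _ ≤ ε := hε.2 ⟨fun i => dN i ω, hdN_sum ω, rfl⟩
end
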